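/- arXiv:2204.10237 — 3 statements merged into one kernel-verified Lean document; each statement's English description precedes it below -/
import Mathlib

section
/- Let n ≥ 1 and let A be an n×n complex matrix. Then the bundle B(A) is open in its closure: there exists an open subset U of the space of n×n complex matrices such that B(A) = U ∩ closure(B(A)). -/
/-- The bundle (under similarity) of an `n × n` complex matrix `A`: the set of matrices `M`
for which there is a bijection `φ : ℂ → ℂ` such that
`rank((M - φ(μ)·I)^k) = rank((A - μ·I)^k)` for all `μ ∈ ℂ` and all `k ∈ ℕ`. -/
def matrixBundle {n : ℕ} (A : Matrix (Fin n) (Fin n) ℂ) : Set (Matrix (Fin n) (Fin n) ℂ) :=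
  {M | ∃ φ : ℂ ≃ ℂ, ∀ (μ : ℂ) (k : ℕ),
    ((M - φ μ • (1 : Matrix (Fin n) (Fin n) ℂ)) ^ k).rank
      = ((A - μ • (1 : Matrix (Fin n) (Fin n) ℂ)) ^ k).rank}

open Matrix Module Topology

/-- The rank of the `k`-th power of `M - z • 1`. -/
noncomputable def shiftRank {n : ℕ} (M : Matrix (Fin n) (Fin n) ℂ) (z : ℂ) (k : ℕ) : ℕ :=
  ((M - z • (1 : Matrix (Fin n) (Fin n) ℂ)) ^ k).rank

section ShiftRank

variable {n : ℕ} (M : Matrix (Fin n) (Fin n) ℂ) (z : ℂ)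

lemma shiftRank_add_finrank_genEigenspace (k : ℕ) :
    shiftRank M z k + finrank ℂ (End.genEigenspace (toLin' M) z k) = n := by
  have h : toLin' ((M - z • (1 : Matrix (Fin n) (Fin n) ℂ)) ^ k)
      = (toLin' M - z • 1) ^ k := by
    rw [toLin'_pow, map_sub, map_smul, toLin'_one]; rfl
  have := LinearMap.finrank_range_add_finrank_ker
    (toLin' ((M - z • (1 : Matrix (Fin n) (Fin n) ℂ)) ^ k))
  rw [End.genEigenspace_nat, ← h]
  rw [finrank_fin_fun] at this
  exact this

lemma shiftRank_le (k : ℕ) : shiftRank M z k ≤ n := by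
  have := shiftRank_add_finrank_genEigenspace M z k
  omega

lemma shiftRank_of_ge {k : ℕ} (hk : n ≤ k) : shiftRank M z k = shiftRank M z n := by
  have h1 := shiftRank_add_finrank_genEigenspace M z k
  have h2 := shiftRank_add_finrank_genEigenspace M z n
  have h3 := End.genEigenspace_eq_genEigenspace_finrank_of_le (toLin' M) z (k := k)
    (by simpa using hk)
  rw [show finrank ℂ (Fin n → ℂ) = n by simp] at h3
  rw [h3] at h1
  omega

lemma shiftRank_add_count_roots : shiftRank M z n + M.charpoly.roots.count z = n := by
  have h := shiftRank_add_finrank_genEigenspace M z n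
  have h3 := End.maxGenEigenspace_eq_genEigenspace_finrank (toLin' M) z
  rw [show finrank ℂ (Fin n → ℂ) = n by simp] at h3
  rw [← h3, LinearMap.finrank_maxGenEigenspace_eq, charpoly_toLin'] at h
  rwa [Polynomial.count_roots]

lemma shiftRank_of_notMem_roots (hz : z ∉ M.charpoly.roots) (k : ℕ) : shiftRank M z k = n := by
  have h := shiftRank_add_finrank_genEigenspace M z k
  have h' := LinearMap.finrank_genEigenspace_le (toLin' M) z k
  rw [charpoly_toLin', ← Polynomial.count_roots, Multiset.count_eq_zero_of_notMem hz] at h'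
  omega

lemma mem_roots_charpoly_iff_shiftRank_lt : z ∈ M.charpoly.roots ↔ shiftRank M z n < n := by
  have h := shiftRank_add_count_roots M z
  rw [← Multiset.one_le_count_iff_mem]
  omega

lemma card_roots_charpoly : M.charpoly.roots.card = n := by
  rw [← (IsAlgClosed.splits M.charpoly).natDegree_eq_card_roots, charpoly_natDegree_eq_dim,
    Fintype.card_fin]

end ShiftRank

lemma isOpen_setOf_le_rank {m n : ℕ} (r : ℕ) :
    IsOpen {M : Matrix (Fin m) (Fin n) ℂ | r ≤ M.rank} := by
  have h : {M : Matrix (Fin m) (Fin n) ℂ | r ≤ M.rank} =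
      ⋃ v : Fin r → Fin n → ℂ, {M | LinearIndependent ℂ fun i => M *ᵥ v i} := by
    ext M
    simp only [Set.mem_ofPred_eq, Set.mem_iUnion]
    constructor
    · intro h
      obtain ⟨f, hf⟩ := exists_linearIndependent_of_le_finrank (R := ℂ)
        (M := LinearMap.range M.mulVecLin) h
      choose v hv using fun i => (f i).2
      refine ⟨v, ?_⟩
      have := hf.map' (LinearMap.range M.mulVecLin).subtype (Submodule.ker_subtype _)
      rwa [show (LinearMap.range M.mulVecLin).subtype ∘ f = fun i => M *ᵥ v i from
        funext fun i => (hv i).symm] at this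
    · rintro ⟨v, hv⟩
      have hv' : LinearIndependent ℂ
          fun i => (⟨M *ᵥ v i, v i, rfl⟩ : LinearMap.range M.mulVecLin) :=
        LinearIndependent.of_comp (LinearMap.range M.mulVecLin).subtype hv
      simpa [Matrix.rank] using hv'.fintype_card_le_finrank
  rw [h]
  refine isOpen_iUnion fun v => isOpen_setOfPred_linearIndependent.preimage ?_
  exact continuous_pi fun i => continuous_id.matrix_mulVec continuous_const

lemma isOpen_setOf_le_shiftRank {n : ℕ} (r k : ℕ) :
    IsOpen {p : Matrix (Fin n) (Fin n) ℂ × ℂ | r ≤ shiftRank p.1 p.2 k} :=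
  (isOpen_setOf_le_rank r).preimage (by fun_prop)

/-- Continuity of roots: near `A` every matrix has an eigenvalue close to a given one of `A`. -/
lemma eventually_exists_mem_roots_charpoly {n : ℕ} {A : Matrix (Fin n) (Fin n) ℂ} {z : ℂ}
    (hz : z ∈ A.charpoly.roots) {K : Set ℂ} (hK : K ∈ 𝓝 z) :
    ∀ᶠ M in 𝓝 A, ∃ w ∈ K, w ∈ M.charpoly.roots := by
  obtain ⟨ε, hε, hεK⟩ := Metric.mem_nhds_iff.1 hK
  have hcont : Continuous fun M : Matrix (Fin n) (Fin n) ℂ => ‖M.charpoly.eval z‖ := by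
    simp only [eval_charpoly]
    fun_prop
  have hA : ‖A.charpoly.eval z‖ < ε ^ n := by
    rw [(Polynomial.mem_roots'.1 hz).2.eq_zero, norm_zero]
    positivity
  filter_upwards [hcont.continuousAt.eventually_lt continuousAt_const hA] with M hM
  by_contra! hcon
  refine hM.not_ge ?_
  have hprod := (IsAlgClosed.splits M.charpoly).eval_eq_prod_roots_of_monic M.charpoly_monic z
  have hpow : ∀ s : Multiset ℂ, (∀ w ∈ s, w ∉ K) →
      ε ^ s.card ≤ ‖(s.map fun w => z - w).prod‖ := fun s => by
    induction s using Multiset.induction_on with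
    | empty => simp
    | cons a s ih =>
      intro hs
      have ha : ε ≤ ‖z - a‖ := by
        rw [← dist_eq_norm, dist_comm]
        exact not_lt.1 fun h => hs a (Multiset.mem_cons_self a s) (hεK h)
      rw [Multiset.card_cons, pow_succ', Multiset.map_cons, Multiset.prod_cons, norm_mul]
      exact mul_le_mul ha (ih fun w hw => hs w (Multiset.mem_cons_of_mem hw)) (by positivity)
        (norm_nonneg _)
  have := hpow M.charpoly.roots fun w hw hwK => hcon w hwK hw
  rwa [card_roots_charpoly, ← hprod] at this

lemma matrixBundle_eq_of_mem {n : ℕ} {A M : Matrix (Fin n) (Fin n) ℂ} (h : M ∈ matrixBundle A) :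
    matrixBundle M = matrixBundle A := by
  obtain ⟨φ, hφ⟩ := h
  ext N
  constructor
  · rintro ⟨ψ, hψ⟩
    exact ⟨φ.trans ψ, fun μ k => (hψ (φ μ) k).trans (hφ μ k)⟩
  · rintro ⟨ψ, hψ⟩
    refine ⟨φ.symm.trans ψ, fun μ k => (hψ (φ.symm μ) k).trans ?_⟩
    rw [← hφ, φ.apply_symm_apply]

/-- If `M` lies in the bundle of `A`, then a choice of distinct eigenvalues of `M`, indexed by the
eigenvalues of `A`, whose shifted ranks dominate those of `A` matches those ranks exactly. -/
lemma shiftRank_eq_of_mem_matrixBundle {n : ℕ} {A M : Matrix (Fin n) (Fin n) ℂ}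
    (hM : M ∈ matrixBundle A) (x : A.charpoly.roots.toFinset → ℂ) (hx : Function.Injective x)
    (hroot : ∀ i, x i ∈ M.charpoly.roots)
    (hle : ∀ i : A.charpoly.roots.toFinset, ∀ k ≤ n, shiftRank A i k ≤ shiftRank M (x i) k)
    (i : A.charpoly.roots.toFinset) (k : ℕ) : shiftRank M (x i) k = shiftRank A i k := by
  obtain ⟨φ, hφ⟩ := hM
  change ∀ μ k, shiftRank M (φ μ) k = shiftRank A μ k at hφ
  have hφ' : ∀ w k, shiftRank M w k = shiftRank A (φ.symm w) k := fun w k => by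
    rw [← hφ, φ.apply_symm_apply]
  let σ : A.charpoly.roots.toFinset → A.charpoly.roots.toFinset := fun i =>
    ⟨φ.symm (x i), by
      rw [Multiset.mem_toFinset, mem_roots_charpoly_iff_shiftRank_lt, ← hφ',
        ← mem_roots_charpoly_iff_shiftRank_lt]
      exact hroot i⟩
  have hσ : Function.Bijective σ := Finite.injective_iff_bijective.1 fun i j hij =>
    hx (φ.symm.injective (congrArg Subtype.val hij))
  have key : ∀ k ≤ n, shiftRank M (x i) k = shiftRank A i k := fun k hk => by
    have hsum : ∑ i, shiftRank A (i : A.charpoly.roots.toFinset) k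
        = ∑ i, shiftRank M (x i) k := by
      simp only [hφ']
      exact (hσ.sum_comp fun j => shiftRank A (j : ℂ) k).symm
    exact ((Finset.sum_eq_sum_iff_of_le fun j _ => hle j k hk).1 hsum i (Finset.mem_univ i)).symm
  rcases le_total k n with hk | hk
  · exact key k hk
  · rw [shiftRank_of_ge _ _ hk, shiftRank_of_ge _ _ hk, key n le_rfl]

lemma mem_matrixBundle_of_shiftRank_eq {n : ℕ} {A N : Matrix (Fin n) (Fin n) ℂ}
    (x : A.charpoly.roots.toFinset → ℂ) (hx : Function.Injective x)
    (h : ∀ i, ∀ k ≤ n, shiftRank N (x i) k = shiftRank A i k) : N ∈ matrixBundle A := by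
  have hall : ∀ i k, shiftRank N (x i) k = shiftRank A i k := fun i k => by
    rcases le_total k n with hk | hk
    · exact h i k hk
    · rw [shiftRank_of_ge _ _ hk, shiftRank_of_ge _ _ hk, h i n le_rfl]
  have hcount : ∀ i, N.charpoly.roots.count (x i) = A.charpoly.roots.count (i : ℂ) := fun i => by
    have h1 := shiftRank_add_count_roots N (x i)
    have h2 := shiftRank_add_count_roots A i
    have h3 := hall i n
    omega
  have hsum : ∑ i, N.charpoly.roots.count (x i) = n := by
    simp only [hcount]
    rw [Finset.sum_coe_sort A.charpoly.roots.toFinset fun z => A.charpoly.roots.count z,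
      Multiset.toFinset_sum_count_eq, card_roots_charpoly]
  have hrange : ∀ w ∈ N.charpoly.roots, w ∈ Set.range x := fun w hw => by
    by_contra hwx
    have hlt : ∑ z ∈ Finset.univ.image x, N.charpoly.roots.count z
        < ∑ z ∈ insert w (Finset.univ.image x), N.charpoly.roots.count z := by
      rw [Finset.sum_insert (by simpa using hwx)]
      have := Multiset.one_le_count_iff_mem.2 hw
      omega
    rw [Finset.sum_image (fun i _ j _ hij => hx hij), hsum] at hlt
    have hsub := Finset.sum_le_sum_of_subset (f := fun z => N.charpoly.roots.count z)
      (Finset.subset_union_left (s₁ := insert w (Finset.univ.image x))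
        (s₂ := N.charpoly.roots.toFinset))
    rw [Multiset.sum_count_eq_card fun a ha =>
      Finset.mem_union_right _ (Multiset.mem_toFinset.2 ha), card_roots_charpoly] at hsub
    omega
  obtain ⟨φ, hφ⟩ := Cardinal.extend_function_of_lt
    (s := (A.charpoly.roots.toFinset : Set ℂ)) ⟨x, hx⟩
    ((Cardinal.lt_aleph0_of_finite _).trans_le (Cardinal.aleph0_le_mk ℂ)) ⟨Equiv.refl ℂ⟩
  refine ⟨φ, fun μ k => ?_⟩
  change shiftRank N (φ μ) k = shiftRank A μ k
  by_cases hμ : μ ∈ A.charpoly.roots.toFinset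
  · exact (congrArg (shiftRank N · k) (hφ ⟨μ, hμ⟩)).trans (hall ⟨μ, hμ⟩ k)
  · rw [shiftRank_of_notMem_roots A μ (by simpa using hμ), shiftRank_of_notMem_roots N]
    intro hroot
    obtain ⟨i, hi⟩ := hrange _ hroot
    have := φ.injective ((hφ i).trans hi)
    exact hμ (this ▸ i.2)

lemma exists_nhds_inter_closure_subset {n : ℕ} (A : Matrix (Fin n) (Fin n) ℂ) :
    ∃ V : Set (Matrix (Fin n) (Fin n) ℂ), IsOpen V ∧ A ∈ V ∧
      V ∩ closure (matrixBundle A) ⊆ matrixBundle A := by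
  set S := A.charpoly.roots.toFinset
  obtain ⟨D, hD, hdisj⟩ := S.finite_toSet.t2_separation
  have hloc : ∀ z : ℂ, ∃ K : Set ℂ, IsCompact K ∧ K ∈ 𝓝 z ∧ K ⊆ D z ∧
      ∀ᶠ M in 𝓝 A, ∀ w ∈ K, ∀ k ≤ n, shiftRank A z k ≤ shiftRank M w k := fun z => by
    have hev : ∀ᶠ p in 𝓝 (A, z), ∀ k ≤ n, shiftRank A z k ≤ shiftRank p.1 p.2 k :=
      (Set.finite_le_nat n).eventually_all.2 fun k _ =>
        (isOpen_setOf_le_shiftRank (shiftRank A z k) k).mem_nhds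
          (le_refl (shiftRank A z k))
    rw [nhds_prod_eq] at hev
    obtain ⟨P, hP, Q, hQ, hPQ⟩ := Filter.eventually_prod_iff.1 hev
    obtain ⟨K, hKz, hKsub, hK⟩ := LocallyCompactSpace.local_compact_nhds z _
      (Filter.inter_mem hQ ((hD z).2.mem_nhds (hD z).1))
    exact ⟨K, hK, hKz, fun w hw => (hKsub hw).2,
      hP.mono fun M hM w hw => hPQ hM (hKsub hw).1⟩
  choose K hKc hKn hKD hKrank using hloc
  have hinj : ∀ x : S → ℂ, (∀ i : S, x i ∈ K i) → Function.Injective x := fun x hx i j hij => by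
    by_contra hne
    exact Set.disjoint_left.1 (hdisj i.2 j.2 fun h => hne (Subtype.ext h))
      (hKD _ (hx i)) (hij ▸ hKD _ (hx j))
  have hnhds : ∀ᶠ M in 𝓝 A, ∀ i : S, (∃ w ∈ K i, w ∈ M.charpoly.roots) ∧
      ∀ w ∈ K i, ∀ k ≤ n, shiftRank A i k ≤ shiftRank M w k :=
    Filter.eventually_all.2 fun i =>
      (eventually_exists_mem_roots_charpoly (Multiset.mem_toFinset.1 i.2) (hKn i)).and (hKrank i)
  obtain ⟨V, hV, hVopen, hAV⟩ := eventually_nhds_iff.1 hnhds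
  refine ⟨V, hVopen, hAV, fun N hN => ?_⟩
  let C : Set (Matrix (Fin n) (Fin n) ℂ × (∀ i : S, K i)) :=
    {p | ∀ i k, shiftRank p.1 (p.2 i) k ≤ shiftRank A i k}
  have hC : IsClosed C := by
    simp only [C, Set.ofPred_forall]
    refine isClosed_iInter fun i => isClosed_iInter fun k => ?_
    have := ((isOpen_setOf_le_shiftRank (n := n) (shiftRank A i k + 1) k).preimage
      (f := fun p : Matrix (Fin n) (Fin n) ℂ × (∀ i : S, K i) => (p.1, (p.2 i : ℂ)))
      (by fun_prop)).isClosed_compl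
    convert this using 1
    ext p
    simp
  have : ∀ i : S, CompactSpace (K i) := fun i => isCompact_iff_compactSpace.1 (hKc i)
  have hproj : IsClosed (Prod.fst '' C) := isClosedMap_fst_of_compactSpace _ hC
  have hsub : V ∩ matrixBundle A ⊆ Prod.fst '' C := fun M hM => by
    choose x hxK hx using fun i => (hV M hM.1 i).1
    exact ⟨(M, fun i => ⟨x i, hxK i⟩), fun i k => (shiftRank_eq_of_mem_matrixBundle hM.2 x
      (hinj x hxK) hx (fun i => (hV M hM.1 i).2 _ (hxK i)) i k).le, rfl⟩
  obtain ⟨⟨_, x⟩, hx, rfl⟩ := closure_minimal hsub hproj (hVopen.inter_closure hN)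
  exact mem_matrixBundle_of_shiftRank_eq (fun i => (x i : ℂ)) (hinj _ fun i => (x i).2)
    fun i k hk => (hx i k).antisymm ((hV _ hN.1 i).2 _ (x i).2 k hk)

/-- Bundles of matrices under similarity are open in their closure. -/
theorem bundle_open_in_closure (n : ℕ) (hn : 1 ≤ n) (A : Matrix (Fin n) (Fin n) ℂ) :
    ∃ U : Set (Matrix (Fin n) (Fin n) ℂ), IsOpen U ∧
      matrixBundle A = U ∩ closure (matrixBundle A) := by
  choose V hVopen hmem hV using exists_nhds_inter_closure_subset (n := n)
  refine ⟨⋃ M ∈ matrixBundle A, V M, isOpen_biUnion fun M _ => hVopen M, ?_⟩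
  refine Set.Subset.antisymm
    (fun M hM => ⟨Set.mem_biUnion hM (hmem M), subset_closure hM⟩) ?_
  rintro N ⟨hNU, hN⟩
  obtain ⟨M, hM, hNV⟩ := Set.mem_iUnion₂.1 hNU
  have := @hV M N
  rw [matrixBundle_eq_of_mem hM] at this
  exact this ⟨hNV, hN⟩
end

section
/- Let n ≥ 1 and let A₁, A₂ be n×n complex matrices. If A₂ belongs to the closure of the bundle B(A₁), then closure(B(A₂)) ⊆ closure(B(A₁)). -/
open Polynomial Module in
theorem finrank_quotient_sup_pow (ν μ : ℂ) (e k : ℕ) :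
    finrank ℂ (ℂ[X] ⧸ (Ideal.span {(X - C ν) ^ e} ⊔ Ideal.span {(X - C μ) ^ k})) =
      if ν = μ then min e k else 0 := by
  split_ifs with h
  · subst h
    have : Ideal.span {(X - C ν) ^ e} ⊔ Ideal.span {(X - C ν) ^ k} =
        Ideal.span {(X - C ν) ^ min e k} := by
      rcases le_total e k with h | h
      · rw [min_eq_left h, sup_eq_left]
        exact Ideal.span_singleton_le_span_singleton.2 (pow_dvd_pow _ h)
      · rw [min_eq_right h, sup_eq_right]
        exact Ideal.span_singleton_le_span_singleton.2 (pow_dvd_pow _ h)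
    rw [this, finrank_quotient_span_eq_natDegree, natDegree_pow, natDegree_X_sub_C, mul_one]
  · have hc : IsCoprime ((X - C ν) ^ e) ((X - C μ) ^ k) :=
      (isCoprime_X_sub_C_of_isUnit_sub (sub_ne_zero.2 h).isUnit).pow
    have : Ideal.span {(X - C ν) ^ e} ⊔ Ideal.span {(X - C μ) ^ k} = (⊤ : Ideal ℂ[X]) := by
      rw [← Ideal.isCoprime_span_singleton_iff, Ideal.isCoprime_iff_sup_eq] at hc
      exact hc
    have : Subsingleton (ℂ[X] ⧸ (Ideal.span {(X - C ν) ^ e} ⊔ Ideal.span {(X - C μ) ^ k})) :=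
      Ideal.Quotient.subsingleton_iff.2 this
    exact finrank_zero_of_subsingleton

open Polynomial Module in
theorem finrank_range_sub_pow_add {V ι : Type*} [AddCommGroup V] [Module ℂ V]
    [FiniteDimensional ℂ V] [Fintype ι] (f : End ℂ V) (ν : ι → ℂ) (e : ι → ℕ)
    (E : AEval' f ≃ₗ[ℂ[X]] ∀ i, ℂ[X] ⧸ Ideal.span {(X - C (ν i)) ^ e i}) (μ : ℂ) (k : ℕ) :
    finrank ℂ (LinearMap.range ((f - algebraMap ℂ (End ℂ V) μ) ^ k)) +
      ∑ i, (if ν i = μ then min (e i) k else 0) = finrank ℂ V := by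
  let ψ : (∀ i, ℂ[X] ⧸ Ideal.span {(X - C (ν i)) ^ e i}) →ₗ[ℂ[X]]
      ∀ i, ℂ[X] ⧸ (Ideal.span {(X - C (ν i)) ^ e i} ⊔ Ideal.span {(X - C μ) ^ k}) :=
    LinearMap.pi fun i => (Submodule.factor le_sup_left) ∘ₗ LinearMap.proj i
  have hψ : ∀ (r : ι → ℂ[X]), ψ (fun i => Submodule.Quotient.mk (r i)) =
      fun i => Submodule.Quotient.mk (r i) := fun r => rfl
  let Ψ : V →ₗ[ℂ] _ :=
    ((ψ ∘ₗ E.toLinearMap).restrictScalars ℂ) ∘ₗ (AEval'.of f).toLinearMap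
  have hE : ∀ v, E (AEval'.of f (((f - algebraMap ℂ (End ℂ V) μ) ^ k) v)) =
      ((X - C μ) ^ k : ℂ[X]) • E (AEval'.of f v) := by
    intro v
    rw [← map_smul, AEval'.of, ← AEval.of_aeval_smul]
    simp
  have hrep : ∀ x : (∀ i, ℂ[X] ⧸ Ideal.span {(X - C (ν i)) ^ e i}),
      ∃ r : ι → ℂ[X], x = fun i => Submodule.Quotient.mk (r i) := by
    intro x
    choose r hr using fun i => Submodule.Quotient.mk_surjective _ (x i)
    exact ⟨r, funext fun i => (hr i).symm⟩
  have hker : LinearMap.ker Ψ = LinearMap.range ((f - algebraMap ℂ (End ℂ V) μ) ^ k) := by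
    apply le_antisymm
    · intro v hv
      obtain ⟨r, hr⟩ := hrep (E (AEval'.of f v))
      have h0 : ψ (E (AEval'.of f v)) = 0 := hv
      rw [hr, hψ] at h0
      have h1 : ∀ i, ∃ s, r i - (X - C μ) ^ k * s ∈ Ideal.span {(X - C (ν i)) ^ e i} := by
        intro i
        have h2 := (Submodule.Quotient.mk_eq_zero _).1 (congrFun h0 i)
        obtain ⟨a, ha, b, hb, hab⟩ := Submodule.mem_sup.1 h2
        obtain ⟨s, rfl⟩ := Ideal.mem_span_singleton'.1 hb
        refine ⟨s, ?_⟩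
        rw [← hab, mul_comm s, add_sub_cancel_right]
        exact ha
      choose s hs using h1
      obtain ⟨y, hy⟩ := E.surjective (fun i => Submodule.Quotient.mk (s i))
      obtain ⟨w, rfl⟩ := (AEval'.of f).surjective y
      refine ⟨w, ?_⟩
      apply (AEval'.of f).injective
      apply E.injective
      rw [hE, hy, hr]
      funext i
      symm
      exact (Submodule.Quotient.eq _).2 (hs i)
    · rintro _ ⟨w, rfl⟩
      obtain ⟨r, hr⟩ := hrep (E (AEval'.of f w))
      change ψ (E (AEval'.of f _)) = 0
      rw [hE, map_smul, hr, hψ]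
      funext i
      refine (Submodule.Quotient.mk_eq_zero _).2 (Submodule.mem_sup_right ?_)
      exact Ideal.mem_span_singleton.2 (dvd_mul_right _ _)
  have hsurj : Function.Surjective Ψ := by
    intro z
    choose r hr using fun i => Submodule.Quotient.mk_surjective _ (z i)
    obtain ⟨y, hy⟩ := E.surjective (fun i => Submodule.Quotient.mk (r i))
    obtain ⟨w, rfl⟩ := (AEval'.of f).surjective y
    refine ⟨w, ?_⟩
    change ψ (E (AEval'.of f _)) = z
    rw [hy, hψ]
    exact funext hr
  have hfin : ∀ i, Module.Finite ℂ
      (ℂ[X] ⧸ (Ideal.span {(X - C (ν i)) ^ e i} ⊔ Ideal.span {(X - C μ) ^ k})) := fun i =>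
    Module.Finite.of_surjective ((LinearMap.proj i) ∘ₗ Ψ)
      ((Function.surjective_eval i).comp hsurj)
  have := Ψ.finrank_range_add_finrank_ker
  rw [hker, LinearMap.range_eq_top.2 hsurj, finrank_top, finrank_pi_fintype, add_comm] at this
  rw [← this]
  congr 1
  exact Finset.sum_congr rfl fun i _ => (finrank_quotient_sup_pow _ _ _ _).symm

open Polynomial Module in
theorem exists_aeval_equiv_pi {V : Type} [AddCommGroup V] [Module ℂ V]
    [FiniteDimensional ℂ V] (f : End ℂ V) :
    ∃ (ι : Type) (_ : Fintype ι) (ν : ι → ℂ) (e : ι → ℕ), (∀ i, 0 < e i) ∧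
      Nonempty (AEval' f ≃ₗ[ℂ[X]] ∀ i, ℂ[X] ⧸ Ideal.span {(X - C (ν i)) ^ e i}) := by
  have htors : Module.IsTorsion ℂ[X] (AEval' f) := by
    intro v
    refine ⟨⟨minpoly ℂ f, mem_nonZeroDivisors_of_ne_zero
      (minpoly.ne_zero (Algebra.IsIntegral.isIntegral f))⟩, ?_⟩
    obtain ⟨w, rfl⟩ := (AEval'.of f).surjective v
    change minpoly ℂ f • (AEval.of ℂ V f w) = 0
    rw [← AEval.of_aeval_smul]
    simp
  obtain ⟨ι, _, p, hp, e, ⟨E⟩⟩ := equiv_directSum_of_isTorsion htors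
  have hν : ∀ i, ∃ ν : ℂ, Associated (p i) (X - C ν) := by
    intro i
    have hdeg := IsAlgClosed.degree_eq_one_of_irreducible ℂ (hp i)
    obtain ⟨ν, hν⟩ := exists_root_of_degree_eq_one hdeg
    exact ⟨ν, ((irreducible_X_sub_C ν).associated_of_dvd (hp i) (dvd_iff_isRoot.2 hν)).symm⟩
  choose ν hν using hν
  have hspan : ∀ i, (Submodule.span ℂ[X] {p i ^ e i}) = Ideal.span {(X - C (ν i)) ^ e i} :=
    fun i => Ideal.span_singleton_eq_span_singleton.2 ((hν i).pow_pow)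
  classical
  let E₁ : AEval' f ≃ₗ[ℂ[X]] ∀ i, ℂ[X] ⧸ Ideal.span {(X - C (ν i)) ^ e i} :=
    E ≪≫ₗ DirectSum.linearEquivFunOnFintype ℂ[X] ι _ ≪≫ₗ
      LinearEquiv.piCongrRight fun i => Submodule.quotEquivOfEq _ _ (hspan i)
  let ρ : (∀ i, ℂ[X] ⧸ Ideal.span {(X - C (ν i)) ^ e i}) →ₗ[ℂ[X]]
      ∀ i : {i // 0 < e i}, ℂ[X] ⧸ Ideal.span {(X - C (ν i)) ^ e i} :=
    LinearMap.pi fun i => LinearMap.proj i.1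
  have hsub : ∀ i, ¬ 0 < e i → Subsingleton (ℂ[X] ⧸ Ideal.span {(X - C (ν i)) ^ e i}) := by
    intro i hi
    rw [Ideal.Quotient.subsingleton_iff, Nat.eq_zero_of_not_pos hi, pow_zero,
      Ideal.span_singleton_one]
  have hρ : Function.Bijective ρ := by
    constructor
    · intro x y hxy
      funext i
      by_cases hi : 0 < e i
      · exact congrFun hxy ⟨i, hi⟩
      · have := hsub i hi
        exact Subsingleton.elim _ _
    · intro z
      refine ⟨fun i => if hi : 0 < e i then z ⟨i, hi⟩ else 0, ?_⟩
      funext i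
      exact dif_pos i.2
  exact ⟨{i // 0 < e i}, inferInstance, fun i => ν i, fun i => e i, fun i => i.2,
    ⟨E₁ ≪≫ₗ LinearEquiv.ofBijective ρ hρ⟩⟩

theorem two_mul_sum_min_succ {ι : Type*} [Fintype ι] [DecidableEq ι] (ν : ι → ℂ) (e : ι → ℕ)
    (μ : ℂ) (k : ℕ) :
    2 * ∑ i, (if ν i = μ then min (e i) (k + 1) else 0) =
      ∑ i, (if ν i = μ then min (e i) k else 0) +
      ∑ i, (if ν i = μ then min (e i) (k + 2) else 0) +
      Fintype.card {i // (ν i, e i) = (μ, k + 1)} := by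
  rw [Fintype.card_subtype, Finset.card_filter, Finset.mul_sum, ← Finset.sum_add_distrib,
    ← Finset.sum_add_distrib]
  refine Finset.sum_congr rfl fun i _ => ?_
  by_cases h : ν i = μ
  · simp only [Prod.mk.injEq, h, true_and, if_true]
    split_ifs <;> omega
  · simp [h]

theorem exists_equiv_of_sum_min_eq {ι κ : Type*} [Fintype ι] [Fintype κ]
    (ν : ι → ℂ) (e : ι → ℕ) (he : ∀ i, 0 < e i) (ν' : κ → ℂ) (e' : κ → ℕ) (he' : ∀ i, 0 < e' i)
    (h : ∀ μ k, ∑ i, (if ν i = μ then min (e i) k else 0) =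
      ∑ i, (if ν' i = μ then min (e' i) k else 0)) :
    ∃ σ : ι ≃ κ, ∀ i, ν' (σ i) = ν i ∧ e' (σ i) = e i := by
  classical
  have hcard : ∀ y : ℂ × ℕ,
      Nonempty ({i // (ν i, e i) = y} ≃ {i // (ν' i, e' i) = y}) := by
    rintro ⟨μ, _ | k⟩
    · have h1 : IsEmpty {i // (ν i, e i) = (μ, 0)} :=
        ⟨fun i => (he i.1).ne' (congrArg Prod.snd i.2)⟩
      have h2 : IsEmpty {i // (ν' i, e' i) = (μ, 0)} :=
        ⟨fun i => (he' i.1).ne' (congrArg Prod.snd i.2)⟩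
      exact ⟨Equiv.equivOfIsEmpty _ _⟩
    · refine Fintype.card_eq.1 ?_
      have h1 := two_mul_sum_min_succ ν e μ k
      have h2 := two_mul_sum_min_succ ν' e' μ k
      rw [h, h, h] at h1
      omega
  let σ : ι ≃ κ := (Equiv.sigmaFiberEquiv fun i => (ν i, e i)).symm.trans
    ((Equiv.sigmaCongrRight fun y => (hcard y).some).trans
      (Equiv.sigmaFiberEquiv fun i => (ν' i, e' i)))
  have hσ : ∀ i, (ν' (σ i), e' (σ i)) = (ν i, e i) := fun i =>
    ((hcard (ν i, e i)).some ⟨i, rfl⟩).2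
  exact ⟨σ, fun i => ⟨congrArg Prod.fst (hσ i), congrArg Prod.snd (hσ i)⟩⟩

open Polynomial Module in
theorem exists_conj_of_finrank_range_eq {V : Type} [AddCommGroup V] [Module ℂ V]
    [FiniteDimensional ℂ V] (f g : End ℂ V)
    (h : ∀ (μ : ℂ) (k : ℕ), finrank ℂ (LinearMap.range ((f - algebraMap ℂ (End ℂ V) μ) ^ k)) =
      finrank ℂ (LinearMap.range ((g - algebraMap ℂ (End ℂ V) μ) ^ k))) :
    ∃ T : V ≃ₗ[ℂ] V, ∀ v, T (f v) = g (T v) := by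
  obtain ⟨ι, _, ν, e, he, ⟨E⟩⟩ := exists_aeval_equiv_pi f
  obtain ⟨κ, _, ν', e', he', ⟨E'⟩⟩ := exists_aeval_equiv_pi g
  obtain ⟨σ, hσ⟩ := exists_equiv_of_sum_min_eq ν e he ν' e' he' fun μ k => by
    have h1 := finrank_range_sub_pow_add f ν e E μ k
    have h2 := finrank_range_sub_pow_add g ν' e' E' μ k
    have h3 := h μ k
    omega
  have hspan : ∀ i, (Ideal.span {(X - C (ν i)) ^ e i} : Ideal ℂ[X]) =
      Ideal.span {(X - C (ν' (σ i))) ^ e' (σ i)} := fun i => by rw [(hσ i).1, (hσ i).2]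
  let T : AEval' f ≃ₗ[ℂ[X]] AEval' g :=
    E ≪≫ₗ (LinearEquiv.piCongrRight fun i => Submodule.quotEquivOfEq _ _ (hspan i)) ≪≫ₗ
      (LinearEquiv.piCongrLeft ℂ[X]
        (fun j => ℂ[X] ⧸ (Ideal.span {(X - C (ν' j)) ^ e' j} : Ideal ℂ[X])) σ) ≪≫ₗ E'.symm
  refine ⟨AEval'.of f ≪≫ₗ T.restrictScalars ℂ ≪≫ₗ (AEval'.of g).symm, fun v => ?_⟩
  change (AEval'.of g).symm (T (AEval'.of f (f v))) = g ((AEval'.of g).symm (T (AEval'.of f v)))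
  rw [← AEval'.X_smul_of, map_smul, AEval'.of_symm_X_smul]

open Matrix in
theorem exists_units_conj_of_rank_eq {n : ℕ} (M N : Matrix (Fin n) (Fin n) ℂ)
    (h : ∀ (μ : ℂ) (k : ℕ), ((M - μ • (1 : Matrix (Fin n) (Fin n) ℂ)) ^ k).rank =
      ((N - μ • (1 : Matrix (Fin n) (Fin n) ℂ)) ^ k).rank) :
    ∃ P : (Matrix (Fin n) (Fin n) ℂ)ˣ, N = P * M * (P⁻¹ : (Matrix (Fin n) (Fin n) ℂ)ˣ) := by
  have hrank : ∀ (A : Matrix (Fin n) (Fin n) ℂ) (μ : ℂ) (k : ℕ),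
      Module.finrank ℂ (LinearMap.range
        ((toLinAlgEquiv' A - algebraMap ℂ (Module.End ℂ (Fin n → ℂ)) μ) ^ k)) =
      ((A - μ • (1 : Matrix (Fin n) (Fin n) ℂ)) ^ k).rank := by
    intro A μ k
    rw [← AlgEquiv.commutes (toLinAlgEquiv' (R := ℂ) (n := Fin n)), ← map_sub, ← map_pow,
      Algebra.algebraMap_eq_smul_one]
    rfl
  obtain ⟨T, hT⟩ := exists_conj_of_finrank_range_eq (toLinAlgEquiv' M) (toLinAlgEquiv' N)
    fun μ k => by rw [hrank, hrank, h]
  let u : (Module.End ℂ (Fin n → ℂ))ˣ := LinearMap.GeneralLinearGroup.ofLinearEquiv T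
  let P : (Matrix (Fin n) (Fin n) ℂ)ˣ :=
    Units.map (toLinAlgEquiv' (R := ℂ) (n := Fin n)).symm.toRingHom.toMonoidHom u
  refine ⟨P, ?_⟩
  rw [Units.eq_mul_inv_iff_mul_eq]
  apply (toLinAlgEquiv' (R := ℂ) (n := Fin n)).injective
  have hP : toLinAlgEquiv' (P : Matrix (Fin n) (Fin n) ℂ) = T.toLinearMap :=
    (toLinAlgEquiv' (R := ℂ) (n := Fin n)).apply_symm_apply _
  rw [map_mul, map_mul, hP]
  exact LinearMap.ext fun v => (hT v).symm

theorem conj_mem_matrixBundle {n : ℕ} {A M : Matrix (Fin n) (Fin n) ℂ}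
    (P : (Matrix (Fin n) (Fin n) ℂ)ˣ) (hM : M ∈ matrixBundle A) :
    (P : Matrix (Fin n) (Fin n) ℂ) * M * (P⁻¹ : (Matrix (Fin n) (Fin n) ℂ)ˣ) ∈
      matrixBundle A := by
  obtain ⟨φ, hφ⟩ := hM
  refine ⟨φ, fun μ k => ?_⟩
  have h1 : (P : Matrix (Fin n) (Fin n) ℂ) * M * (P⁻¹ : (Matrix (Fin n) (Fin n) ℂ)ˣ) - φ μ • 1 =
      P * (M - φ μ • 1) * (P⁻¹ : (Matrix (Fin n) (Fin n) ℂ)ˣ) := by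
    rw [mul_sub, sub_mul, mul_smul_comm, mul_one, smul_mul_assoc, Units.mul_inv]
  rw [h1, Units.conj_pow, Matrix.rank_mul_eq_left_of_isUnit_det _ _
    ((Matrix.isUnit_iff_isUnit_det _).1 (Units.isUnit _)),
    Matrix.rank_mul_eq_right_of_isUnit_det _ _
    ((Matrix.isUnit_iff_isUnit_det _).1 (Units.isUnit _)), hφ]

theorem matrixBundle_subset_of_mem {n : ℕ} {A M : Matrix (Fin n) (Fin n) ℂ}
    (hM : M ∈ matrixBundle A) : matrixBundle M ⊆ matrixBundle A := by
  obtain ⟨φ, hφ⟩ := hM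
  rintro N ⟨ψ, hψ⟩
  exact ⟨φ.trans ψ, fun μ k => (hψ (φ μ) k).trans (hφ μ k)⟩

namespace Polynomial

/-- The divided difference `(f - f(μ)) / (X - μ)`. -/
noncomputable def dividedDifference (f : ℂ[X]) (μ : ℂ) : ℂ[X] :=
  ∑ i ∈ f.support, C (f.coeff i) * ∑ j ∈ Finset.range i, X ^ j * C μ ^ (i - 1 - j)

theorem dividedDifference_mul (f : ℂ[X]) (μ : ℂ) :
    f.dividedDifference μ * (X - C μ) = f - C (f.eval μ) := by
  rw [dividedDifference, Finset.sum_mul]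
  simp_rw [mul_assoc, geom_sum₂_mul, mul_sub, Finset.sum_sub_distrib]
  congr 1
  · exact f.as_sum_support_C_mul_X_pow.symm
  · rw [eval_eq_sum, sum_def, map_sum]
    simp

theorem eval_dividedDifference_self (f : ℂ[X]) (μ : ℂ) :
    (f.dividedDifference μ).eval μ = f.derivative.eval μ := by
  have := congrArg (fun p => eval μ (derivative p)) (f.dividedDifference_mul μ)
  simpa using this

theorem eval_dividedDifference_mul (f : ℂ[X]) (μ ν : ℂ) :
    (f.dividedDifference μ).eval ν * (ν - μ) = f.eval ν - f.eval μ := by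
  have := congrArg (eval ν) (f.dividedDifference_mul μ)
  simpa using this

theorem continuous_dividedDifference (f : ℂ[X]) :
    Continuous fun z : ℂ × ℂ => (f.dividedDifference z.1).eval z.2 := by
  simp only [dividedDifference, eval_finsetSum, eval_mul, eval_C, eval_pow, eval_X]
  fun_prop

theorem injOn_eval_of_dividedDifference_ne_zero {f : ℂ[X]} {s : Set ℂ}
    (h : ∀ μ ∈ s, ∀ ν ∈ s, (f.dividedDifference μ).eval ν ≠ 0) :
    Set.InjOn (fun z => f.eval z) s := by
  intro μ hμ ν hν hμν
  have h1 := f.eval_dividedDifference_mul μ ν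
  have h2 : f.eval ν - f.eval μ = 0 := sub_eq_zero.2 hμν.symm
  rw [h2] at h1
  exact (sub_eq_zero.1 ((mul_eq_zero.1 h1).resolve_left (h μ hμ ν hν))).symm

theorem exists_eval_eq_derivative_ne_zero {s : Set ℂ} (hs : s.Finite) (φ : ℂ → ℂ) :
    ∃ f : ℂ[X], (∀ μ ∈ s, f.eval μ = φ μ) ∧ ∀ μ ∈ s, f.derivative.eval μ ≠ 0 := by
  lift s to Finset ℂ using hs
  let L := Lagrange.interpolate s id φ
  let N : ℂ[X] := Lagrange.nodal s id
  obtain ⟨c, hc⟩ := (s.finite_toSet.image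
    fun μ => -(eval μ (derivative L)) / eval μ (derivative N)).exists_notMem
  refine ⟨L + C c * N, fun μ hμ => ?_, fun μ hμ h0 => hc ⟨μ, hμ, ?_⟩⟩
  · have h1 : eval μ L = φ μ := Lagrange.eval_interpolate_at_node φ (v := id)
      Function.injective_id.injOn hμ
    have h2 : eval μ N = 0 := Lagrange.eval_nodal_at_node (v := id) hμ
    simp [h1, h2]
  · have h3 : eval μ (derivative N) ≠ 0 := by
      have h4 : eval μ (derivative N) = eval μ (Lagrange.nodal (s.erase μ) id) :=
        Lagrange.eval_nodal_derivative_eval_node_eq (v := id) hμ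
      rw [h4]
      refine Lagrange.eval_nodal_not_at_node fun i hi => ?_
      exact (Finset.ne_of_mem_erase hi).symm
    simp only [derivative_add, derivative_C_mul, eval_add, eval_mul, eval_C] at h0
    rw [div_eq_iff h3]
    linear_combination -h0

end Polynomial

open Polynomial in
theorem rank_aeval_sub_pow {n : ℕ} (hn : 1 ≤ n) (A : Matrix (Fin n) (Fin n) ℂ) (f : ℂ[X])
    (φ : ℂ ≃ ℂ) (hφ : ∀ μ ∈ spectrum ℂ A, φ μ = f.eval μ)
    (hf : ∀ μ ∈ spectrum ℂ A, ∀ ν ∈ spectrum ℂ A, (f.dividedDifference μ).eval ν ≠ 0)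
    (μ : ℂ) (k : ℕ) :
    ((aeval A f - φ μ • (1 : Matrix (Fin n) (Fin n) ℂ)) ^ k).rank =
      ((A - μ • (1 : Matrix (Fin n) (Fin n) ℂ)) ^ k).rank := by
  have : Nonempty (Fin n) := ⟨⟨0, hn⟩⟩
  have hne := spectrum.nonempty_of_isAlgClosed_of_finiteDimensional ℂ A
  have hunit : ∀ (B : Matrix (Fin n) (Fin n) ℂ) (z : ℂ), z ∉ spectrum ℂ B →
      IsUnit (B - z • (1 : Matrix (Fin n) (Fin n) ℂ)) := by
    intro B z hz
    rw [spectrum.notMem_iff, Algebra.algebraMap_eq_smul_one] at hz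
    simpa using hz.neg
  by_cases hμ : μ ∈ spectrum ℂ A
  · have hfac : aeval A f - φ μ • (1 : Matrix (Fin n) (Fin n) ℂ) =
        aeval A (f.dividedDifference μ) * (A - μ • (1 : Matrix (Fin n) (Fin n) ℂ)) := by
      have := congrArg (aeval A) (f.dividedDifference_mul μ)
      simp only [map_mul, map_sub, aeval_X, aeval_C, Algebra.algebraMap_eq_smul_one] at this
      rw [hφ μ hμ, this]
    have hcomm : Commute (aeval A (f.dividedDifference μ))
        (A - μ • (1 : Matrix (Fin n) (Fin n) ℂ)) := by
      have h1 : A - μ • (1 : Matrix (Fin n) (Fin n) ℂ) = aeval A (X - C μ) := by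
        simp [Algebra.algebraMap_eq_smul_one]
      rw [h1]
      exact (Commute.all _ _).map (aeval A)
    have hD : IsUnit (aeval A (f.dividedDifference μ)) := by
      rw [← spectrum.zero_notMem_iff ℂ, spectrum.map_polynomial_aeval_of_nonempty _ _ hne]
      rintro ⟨ν, hν, h0⟩
      exact hf μ hμ ν hν h0
    rw [hfac, hcomm.mul_pow, Matrix.rank_mul_eq_right_of_isUnit_det _ _
      ((Matrix.isUnit_iff_isUnit_det _).1 (hD.pow k))]
  · have hμ' : φ μ ∉ spectrum ℂ (aeval A f) := by
      rw [spectrum.map_polynomial_aeval_of_nonempty _ _ hne]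
      rintro ⟨ν, hν, h0⟩
      have h1 : φ ν = φ μ := (hφ ν hν).trans h0
      exact hμ (φ.injective h1 ▸ hν)
    rw [Matrix.rank_of_isUnit _ ((hunit _ _ hμ').pow k), Matrix.rank_of_isUnit _
      ((hunit _ _ hμ).pow k)]

open Polynomial in
theorem aeval_mem_matrixBundle {n : ℕ} (hn : 1 ≤ n) (A : Matrix (Fin n) (Fin n) ℂ) (f : ℂ[X])
    (hf : ∀ μ ∈ spectrum ℂ A, ∀ ν ∈ spectrum ℂ A, (f.dividedDifference μ).eval ν ≠ 0) :
    aeval A f ∈ matrixBundle A := by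
  have hfin : (spectrum ℂ A).Finite := A.finite_spectrum
  have hinj := injOn_eval_of_dividedDifference_ne_zero hf
  obtain ⟨φ, hφ⟩ := Cardinal.extend_function_of_lt
    (⟨(spectrum ℂ A).domRestrict fun z => f.eval z, Set.injOn_iff_injective.1 hinj⟩ :
      spectrum ℂ A ↪ ℂ)
    ((Cardinal.mk_lt_aleph0_iff.2 hfin).trans_le (Cardinal.aleph0_le_mk ℂ)) ⟨Equiv.refl ℂ⟩
  exact ⟨φ, rank_aeval_sub_pow hn A f φ (fun μ hμ => hφ ⟨μ, hμ⟩) hf⟩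

open Polynomial Topology in
theorem eventually_dividedDifference_ne_zero {n : ℕ} (A : Matrix (Fin n) (Fin n) ℂ) (f : ℂ[X])
    (hf : ∀ μ ∈ spectrum ℂ A, ∀ ν ∈ spectrum ℂ A, (f.dividedDifference μ).eval ν ≠ 0) :
    ∀ᶠ B in 𝓝 A, ∀ μ ∈ spectrum ℂ B, ∀ ν ∈ spectrum ℂ B,
      (f.dividedDifference μ).eval ν ≠ 0 := by
  let _ : NormedRing (Matrix (Fin n) (Fin n) ℂ) := Matrix.linftyOpNormedRing
  let _ : NormedAlgebra ℂ (Matrix (Fin n) (Fin n) ℂ) := Matrix.linftyOpNormedAlgebra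
  have hK : IsCompact (spectrum ℂ A) := A.finite_spectrum.isCompact
  obtain ⟨U, V, hU, hV, hAU, hAV, hUV⟩ := generalized_tube_lemma hK hK
    (isOpen_ne.preimage f.continuous_dividedDifference) (fun z hz => hf z.1 hz.1 z.2 hz.2)
  have : CompleteSpace (Matrix (Fin n) (Fin n) ℂ) := FiniteDimensional.complete ℂ _
  have h := upperHemicontinuousAt_iff_forall_isOpen.1
    (upperHemicontinuous_iff.1 (upperHemicontinuous_spectrum ℂ (Matrix (Fin n) (Fin n) ℂ)) A)
    (U ∩ V) (hU.inter hV) (Set.subset_inter hAU hAV)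
  filter_upwards [h] with B hB μ hμ ν hν
  exact hUV (Set.mk_mem_prod (hB hμ).1 (hB hν).2)

/-- If `A₂` belongs to the closure of the bundle of `A₁`, then the closure of the bundle of
`A₂` is contained in the closure of the bundle of `A₁`. -/
theorem closure_bundle_subset_of_mem_closure (n : ℕ) (hn : 1 ≤ n)
    (A₁ A₂ : Matrix (Fin n) (Fin n) ℂ) (h : A₂ ∈ closure (matrixBundle A₁)) :
    closure (matrixBundle A₂) ⊆ closure (matrixBundle A₁) := by
  refine closure_minimal ?_ isClosed_closure
  rintro M ⟨φ, hφ⟩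
  obtain ⟨f, hf, hf'⟩ := Polynomial.exists_eval_eq_derivative_ne_zero A₂.finite_spectrum φ
  have hD : ∀ μ ∈ spectrum ℂ A₂, ∀ ν ∈ spectrum ℂ A₂, (f.dividedDifference μ).eval ν ≠ 0 := by
    intro μ hμ ν hν h0
    by_cases hμν : ν = μ
    · rw [hμν, f.eval_dividedDifference_self] at h0
      exact hf' μ hμ h0
    · have h1 := f.eval_dividedDifference_mul μ ν
      rw [h0, zero_mul, hf μ hμ, hf ν hν] at h1
      exact hμν (φ.injective (sub_eq_zero.1 h1.symm))
  obtain ⟨P, rfl⟩ := exists_units_conj_of_rank_eq (Polynomial.aeval A₂ f) M fun μ k => by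
    obtain ⟨ν, rfl⟩ := φ.surjective μ
    rw [hφ, rank_aeval_sub_pow hn A₂ f φ (fun μ hμ => (hf μ hμ).symm) hD]
  have hcont : Continuous fun B : Matrix (Fin n) (Fin n) ℂ =>
      (P : Matrix (Fin n) (Fin n) ℂ) * Polynomial.aeval B f *
        (P⁻¹ : (Matrix (Fin n) (Fin n) ℂ)ˣ) :=
    (continuous_const.mul f.continuous_aeval).mul continuous_const
  rw [mem_closure_iff_frequently] at h ⊢
  refine hcont.continuousAt.tendsto.frequently
    ((h.and_eventually (eventually_dividedDifference_ne_zero A₂ f hD)).mono ?_)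
  rintro B ⟨hB, hBf⟩
  exact conj_mem_matrixBundle P
    (matrixBundle_subset_of_mem hB (aeval_mem_matrixBundle hn B f hBf))
end

section
/- Let n ≥ 1 and let A₁, A₂ be n×n complex matrices. Then A₂ belongs to the closure of the similarity orbit of A₁ (i.e., of the set { P·A₁·P⁻¹ : P an invertible n×n complex matrix }) if and only if rank((A₂ − μ·I)^k) ≤ rank((A₁ − μ·I)^k) for all μ ∈ ℂ and all natural numbers k. -/
open Module

section LinearAlgebra

variable {K V U : Type*} [Field K] [AddCommGroup V] [Module K V] [FiniteDimensional K V]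
  [AddCommGroup U] [Module K U]

theorem finrank_ker_pow_succ (f : End K V) (m : ℕ) :
    finrank K (LinearMap.ker (f ^ (m + 1))) =
      finrank K (LinearMap.ker f) +
        finrank K (LinearMap.ker (f ^ m) ⊓ LinearMap.range f : Submodule K V) := by
  have h1 : LinearMap.ker (f ^ (m + 1)) = (LinearMap.ker (f ^ m)).comap f := by
    rw [pow_succ, Module.End.mul_eq_comp, LinearMap.ker_comp]
  have h2 : LinearMap.range (f.domRestrict (LinearMap.ker (f ^ (m + 1)))) =
      LinearMap.ker (f ^ m) ⊓ LinearMap.range f := by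
    rw [LinearMap.range_domRestrict, h1, Submodule.map_comap_eq, inf_comm]
  have h3 : LinearMap.ker f ≤ LinearMap.ker (f ^ (m + 1)) := by
    rw [pow_succ, Module.End.mul_eq_comp]
    exact LinearMap.ker_le_ker_comp _ _
  have h4 : finrank K (LinearMap.ker (f.domRestrict (LinearMap.ker (f ^ (m + 1))))) =
      finrank K (LinearMap.ker f) := by
    rw [LinearMap.ker_domRestrict]
    exact (Submodule.comapSubtypeEquivOfLe h3).finrank_eq
  rw [← h2, ← h4, Nat.add_comm (finrank K _)]
  exact (LinearMap.finrank_range_add_finrank_ker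
    (f.domRestrict (LinearMap.ker (f ^ (m + 1))))).symm

theorem finrank_ker_pow_succ_le (f : End K V) (m : ℕ) :
    finrank K (LinearMap.ker (f ^ (m + 1))) ≤
      finrank K (LinearMap.ker f) + finrank K (LinearMap.ker (f ^ m)) := by
  rw [finrank_ker_pow_succ]
  gcongr
  exact Submodule.finrank_mono (inf_le_left : LinearMap.ker (f ^ m) ⊓ LinearMap.range f ≤ _)

/-- If `(ker f ^ m + range f) / range f` has dimension at least two, there are vectors `e`, `w` in
kernels of powers of `f`, independent modulo `range f`, and a functional separating them. -/
theorem exists_functional_separating_kernels (f : End K V) (m : ℕ)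
    (h : finrank K (LinearMap.ker (f ^ (m + 1))) + 2 ≤
      finrank K (LinearMap.ker f) + finrank K (LinearMap.ker (f ^ m))) :
    ∃ (k : ℕ) (e w : V) (φ : V →ₗ[K] K), k < m ∧ LinearMap.ker (f ^ k) ≤ LinearMap.range f ∧
      e ∈ LinearMap.ker (f ^ (k + 1)) ∧ w ∈ LinearMap.ker (f ^ m) ∧ w ∉ LinearMap.range f ∧
      φ ∘ₗ f = 0 ∧ φ w = 0 ∧ φ e = 1 := by
  classical
  have hdim := Submodule.finrank_sup_add_finrank_inf_eq (LinearMap.ker (f ^ m))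
    (LinearMap.range f)
  rw [finrank_ker_pow_succ] at h
  have hex : ∃ k, ¬ LinearMap.ker (f ^ k) ≤ LinearMap.range f := by
    refine ⟨m, fun hle => ?_⟩
    rw [inf_eq_left.2 hle] at h
    omega
  have hspec := Nat.find_spec hex
  have hmin := fun {j} => Nat.find_min (H := hex) (m := j)
  have hle : Nat.find hex ≤ m := Nat.find_min' hex fun hle => by
    rw [inf_eq_left.2 hle] at h
    omega
  obtain ⟨k, hk⟩ : ∃ k, Nat.find hex = k + 1 := by
    refine Nat.exists_eq_succ_of_ne_zero fun h0 => ?_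
    rw [h0] at hspec
    simp [Module.End.one_eq_id] at hspec
  rw [hk] at hspec hle
  obtain ⟨e, he, her⟩ := SetLike.not_le_iff_exists.1 hspec
  have hw : ¬ LinearMap.ker (f ^ m) ≤ LinearMap.range f ⊔ Submodule.span K {e} := by
    intro hle
    have h1 : finrank K (LinearMap.ker (f ^ m) ⊔ LinearMap.range f : Submodule K V) ≤
        finrank K (LinearMap.range f ⊔ Submodule.span K {e} : Submodule K V) :=
      Submodule.finrank_mono (sup_le hle le_sup_left)
    have h2 := Submodule.finrank_add_le_finrank_add_finrank (LinearMap.range f)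
      (Submodule.span K {e})
    have h3 := finrank_span_le_card (R := K) ({e} : Set V)
    simp only [Set.toFinset_singleton, Finset.card_singleton] at h3
    omega
  obtain ⟨w, hwm, hw⟩ := SetLike.not_le_iff_exists.1 hw
  have hwr : w ∉ LinearMap.range f := fun h => hw (Submodule.mem_sup_left h)
  have hew : e ∉ LinearMap.range f ⊔ Submodule.span K {w} := by
    intro hmem
    obtain ⟨y, hy, z, hz, hyz⟩ := Submodule.mem_sup.1 hmem
    obtain ⟨c, rfl⟩ := Submodule.mem_span_singleton.1 hz
    rcases eq_or_ne c 0 with rfl | hc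
    · exact her (by simpa [← hyz] using hy)
    · refine hw ?_
      have : w = c⁻¹ • (e - y) := by
        rw [← hyz, add_sub_cancel_left, inv_smul_smul₀ hc]
      rw [this]
      exact Submodule.smul_mem _ _ (Submodule.sub_mem _
        (Submodule.mem_sup_right (Submodule.mem_span_singleton_self e))
        (Submodule.mem_sup_left hy))
  obtain ⟨φ, hφe, hφ⟩ := Submodule.exists_le_ker_of_notMem hew
  refine ⟨k, e, w, (φ e)⁻¹ • φ, by omega, not_not.1 (hmin (by omega)), he, hwm, hwr, ?_, ?_, ?_⟩
  · ext v
    have : φ (f v) = 0 := hφ (Submodule.mem_sup_left ⟨v, rfl⟩)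
    simp [this]
  · have : φ w = 0 := hφ (Submodule.mem_sup_right (Submodule.mem_span_singleton_self w))
    simp [this]
  · simp [hφe]

omit [FiniteDimensional K V] in
theorem ker_sub_pow_le_of_eqOn {f g : End K V} {ν : K}
    (h : ∀ k, ∀ v ∈ LinearMap.ker ((f - algebraMap K (End K V) ν) ^ k), f v = g v) (k : ℕ) :
    LinearMap.ker ((f - algebraMap K (End K V) ν) ^ k) ≤
      LinearMap.ker ((g - algebraMap K (End K V) ν) ^ k) := by
  induction k with
  | zero => simp
  | succ k ih =>
    intro v hv
    have hfg := h _ v hv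
    rw [LinearMap.mem_ker, pow_succ, Module.End.mul_apply] at hv ⊢
    have := ih hv
    rwa [LinearMap.mem_ker, LinearMap.sub_apply, hfg, ← LinearMap.sub_apply] at this

omit [FiniteDimensional K V] in
theorem ker_sub_pow_le_range_pow (f : End K V) {ν : K} (hν : ν ≠ 0) (k m : ℕ) :
    LinearMap.ker ((f - algebraMap K (End K V) ν) ^ k) ≤ LinearMap.range (f ^ m) := by
  intro v hv
  have hc : IsCoprime ((Polynomial.X : Polynomial K) ^ m)
      ((Polynomial.X - Polynomial.C ν) ^ k) := by
    have := (Polynomial.isCoprime_X_sub_C_of_isUnit_sub (a := (0 : K)) (b := ν)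
      (by simpa using hν)).pow (m := m) (n := k)
    simpa using this
  obtain ⟨p, q, hpq⟩ := hc
  have := congrArg (fun r => Polynomial.aeval f r v) hpq
  simp only [map_add, map_mul, map_pow, map_sub, Polynomial.aeval_X, Polynomial.aeval_C,
    LinearMap.add_apply, Module.End.mul_apply, map_one, Module.End.one_apply] at this
  rw [LinearMap.mem_ker.1 hv, map_zero, add_zero] at this
  rw [← this]
  have hcomm : Commute (Polynomial.aeval f p) (f ^ m) := by
    have : f ^ m = Polynomial.aeval f ((Polynomial.X : Polynomial K) ^ m) := by simp
    rw [this]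
    exact (Commute.all _ _).map _
  rw [← Module.End.mul_apply, hcomm.eq]
  exact ⟨_, rfl⟩

/-- A rank-one modification of `f` moving one step up in the dominance order of the Weyr
characteristic of the eigenvalue `0`. -/
theorem exists_rank_one_modification (f : End K V) (m : ℕ)
    (h : finrank K (LinearMap.ker (f ^ (m + 1))) + 2 ≤
      finrank K (LinearMap.ker f) + finrank K (LinearMap.ker (f ^ m))) :
    ∃ E : End K V, ∀ t : K, t ≠ 0 →
      (∀ k, finrank K (LinearMap.ker ((f + t • E) ^ k)) ≤ finrank K (LinearMap.ker (f ^ k))) ∧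
      (∃ k ≤ m, finrank K (LinearMap.ker ((f + t • E) ^ k)) <
        finrank K (LinearMap.ker (f ^ k))) ∧
      (∀ k, m < k → (f + t • E) ^ k = f ^ k) ∧
      (∀ k, finrank K (LinearMap.ker (f ^ k)) ≤
        finrank K (LinearMap.ker ((f + t • E) ^ k)) + 1) ∧
      (∀ ν : K, ν ≠ 0 → ∀ k, LinearMap.ker ((f + t • E - algebraMap K (End K V) ν) ^ k) =
        LinearMap.ker ((f - algebraMap K (End K V) ν) ^ k)) := by
  obtain ⟨k₀, e, w, φ, hk₀, hker, he, hw, hwr, hφf, hφw, hφe⟩ :=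
    exists_functional_separating_kernels f m h
  have hφf' : ∀ v, φ (f v) = 0 := fun v => LinearMap.congr_fun hφf v
  refine ⟨φ.smulRight w, fun t ht => ?_⟩
  set g := f + t • φ.smulRight w with hg
  have hg1 : ∀ v, g v = f v + (t * φ v) • w := fun v => by simp [hg, mul_smul]
  have hgk : ∀ k v, (g ^ (k + 1)) v = (f ^ (k + 1)) v + (t * φ v) • (f ^ k) w := by
    intro k
    induction k with
    | zero => simpa using hg1
    | succ k ih =>
      intro v
      have hk : φ ((f ^ k) w) = 0 := by
        cases k with
        | zero => simpa using hφw
        | succ k => rw [pow_succ', Module.End.mul_apply, hφf']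
      have hk' : φ ((f ^ (k + 1)) v) = 0 := by rw [pow_succ', Module.End.mul_apply, hφf']
      rw [pow_succ' g, Module.End.mul_apply, ih, hg1, pow_succ' f (k + 1), Module.End.mul_apply]
      rw [map_add φ, hk', map_smul φ, hk, map_add, map_smul, pow_succ' f k, Module.End.mul_apply]
      simp
  have hφg : ∀ v, φ v = 0 → g v = f v := fun v hv => by simp [hg1, hv]
  have htop : ∀ k, m < k → g ^ k = f ^ k := by
    intro k hk
    obtain ⟨j, rfl⟩ : ∃ j, k = m + j + 1 := ⟨k - m - 1, by omega⟩
    ext v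
    have : (f ^ (m + j)) w = 0 := by
      rw [add_comm, pow_add, Module.End.mul_apply, LinearMap.mem_ker.1 hw, map_zero]
    rw [hgk, this, smul_zero, add_zero]
  have hlow : ∀ k ≤ k₀, LinearMap.ker (g ^ (k + 1)) ≤ LinearMap.ker (f ^ (k + 1)) ⊓
      LinearMap.ker φ := by
    intro k hk v hv
    rw [LinearMap.mem_ker, hgk] at hv
    have hv' : f v + (t * φ v) • w ∈ LinearMap.ker (f ^ k) := by
      rw [LinearMap.mem_ker, map_add, map_smul, ← Module.End.mul_apply, ← pow_succ, hv]
    have hkk : LinearMap.ker (f ^ k) ≤ LinearMap.ker (f ^ k₀) := by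
      intro x hx
      obtain ⟨j, rfl⟩ := Nat.exists_eq_add_of_le' hk
      rw [LinearMap.mem_ker, pow_add, Module.End.mul_apply, LinearMap.mem_ker.1 hx, map_zero]
    have hφv : φ v = 0 := by
      by_contra hφv
      refine hwr ?_
      have h1 : (t * φ v) • w ∈ LinearMap.range f := by
        have := Submodule.sub_mem _ (hker (hkk hv')) (⟨v, rfl⟩ : f v ∈ LinearMap.range f)
        simpa using this
      exact (Submodule.smul_mem_iff _ (mul_ne_zero ht hφv)).1 h1
    refine ⟨?_, hφv⟩
    simpa [hφv] using hv
  refine ⟨fun k => ?_, ⟨k₀ + 1, hk₀, ?_⟩, htop, fun k => ?_, fun ν hν k => ?_⟩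
  · rcases k with _ | k
    · exact le_rfl
    rcases le_total k k₀ with hk | hk
    · exact Submodule.finrank_mono ((hlow k hk).trans inf_le_left)
    · have hr : LinearMap.range (f ^ (k + 1)) ≤ LinearMap.range (g ^ (k + 1)) := by
        rintro _ ⟨v, rfl⟩
        refine ⟨v - φ v • e, ?_⟩
        have : (f ^ (k + 1)) e = 0 := by
          obtain ⟨j, rfl⟩ := Nat.exists_eq_add_of_le' hk
          rw [add_assoc, pow_add, Module.End.mul_apply, LinearMap.mem_ker.1 he, map_zero]
        simp [hgk, hφe, this]
      have h1 := Submodule.finrank_mono hr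
      have h2 := LinearMap.finrank_range_add_finrank_ker (f ^ (k + 1))
      have h3 := LinearMap.finrank_range_add_finrank_ker (g ^ (k + 1))
      omega
  · refine Submodule.finrank_lt_finrank_of_lt (lt_of_le_of_lt (hlow k₀ le_rfl) ?_)
    refine lt_of_le_of_ne inf_le_left fun heq => ?_
    rw [← heq] at he
    simpa [hφe] using he.2
  · have h1 : LinearMap.ker (f ^ k) ⊓ LinearMap.ker φ ≤ LinearMap.ker (g ^ k) := by
      rintro v ⟨hv, hφv⟩
      rcases k with _ | k
      · exact hv
      · rw [LinearMap.mem_ker, hgk, LinearMap.mem_ker.1 hv, LinearMap.mem_ker.1 hφv]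
        simp
    have h2 := Submodule.finrank_mono h1
    have h3 := Submodule.finrank_sup_add_finrank_inf_eq (LinearMap.ker (f ^ k)) (LinearMap.ker φ)
    have h4 := Submodule.finrank_le (LinearMap.ker (f ^ k) ⊔ LinearMap.ker φ)
    have h5 := LinearMap.finrank_range_add_finrank_ker φ
    have h6 := Submodule.finrank_le (LinearMap.range φ)
    rw [finrank_self] at h6
    omega
  · have hφ : ∀ v, v ∈ LinearMap.range (f ^ (m + 1)) → g v = f v := by
      rintro _ ⟨v, rfl⟩
      exact hφg _ (by rw [pow_succ', Module.End.mul_apply, hφf'])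
    refine le_antisymm (ker_sub_pow_le_of_eqOn (fun k v hv => hφ v ?_) k)
      (ker_sub_pow_le_of_eqOn (fun k v hv => (hφ v ?_).symm) k)
    · rw [← htop _ m.lt_succ_self]
      exact ker_sub_pow_le_range_pow g hν k _ hv
    · exact ker_sub_pow_le_range_pow f hν k _ hv

/-- Two factorizations of the same endomorphism are intertwined by an automorphism. -/
theorem exists_equiv_intertwining {X X' : U →ₗ[K] V} {Y Y' : V →ₗ[K] U}
    (hX : Function.Injective X) (hX' : Function.Injective X')
    (hY : Function.Surjective Y) (hY' : Function.Surjective Y')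
    (h : Y ∘ₗ X = Y' ∘ₗ X') :
    ∃ P : V ≃ₗ[K] V, P ∘ₗ X = X' ∧ Y' ∘ₗ P = Y := by
  obtain ⟨L, hL⟩ := X.exists_leftInverse_of_injective (LinearMap.ker_eq_bot.2 hX)
  obtain ⟨R, hR⟩ := Y'.exists_rightInverse_of_surjective (LinearMap.range_eq_top.2 hY')
  have hL' : ∀ u, L (X u) = u := fun u => LinearMap.congr_fun hL u
  have hR' : ∀ u, Y' (R u) = u := fun u => LinearMap.congr_fun hR u
  have h' : ∀ u, Y (X u) = Y' (X' u) := fun u => LinearMap.congr_fun h u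
  let f : End K V := X' ∘ₗ L + R ∘ₗ Y - R ∘ₗ Y ∘ₗ X ∘ₗ L
  have hf : ∀ v, f v = X' (L v) + R (Y v) - R (Y (X (L v))) := fun v => rfl
  have hfX : ∀ u, f (X u) = X' u := fun u => by simp [hf, hL']
  have hfY : ∀ v, Y' (f v) = Y v := fun v => by simp [hf, hR', h']
  have hdisj : Disjoint (LinearMap.range X) (LinearMap.ker f) := by
    rw [Submodule.disjoint_def]
    rintro _ ⟨u, rfl⟩ hu
    rw [LinearMap.mem_ker, hfX] at hu
    rw [hX' (hu.trans (map_zero X').symm), map_zero]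
  have hcod : Codisjoint (LinearMap.range f) (LinearMap.ker Y') := by
    rw [codisjoint_iff, eq_top_iff]
    intro v _
    obtain ⟨x, hx⟩ := hY (Y' v)
    refine Submodule.mem_sup.2 ⟨f x, ⟨x, rfl⟩, v - f x, ?_, by simp⟩
    simp [hfY, hx]
  obtain ⟨D, hXD, hD⟩ := hdisj.exists_isCompl
  obtain ⟨C, hCY, hC⟩ := hcod.symm.exists_isCompl
  have hfin : finrank K (LinearMap.ker f) = finrank K C := by
    have h1 := LinearMap.finrank_range_add_finrank_ker f
    have h2 := Submodule.finrank_add_eq_of_isCompl hC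
    omega
  let i := LinearEquiv.ofFinrankEq (LinearMap.ker f) C hfin
  let Z : End K V := C.subtype ∘ₗ i.toLinearMap ∘ₗ Submodule.projectionOnto _ _ hD.symm
  have hZD : ∀ v ∈ D, Z v = 0 := fun v hv => by
    simp [Z, Submodule.projectionOnto_apply_of_mem_right hD.symm hv]
  have hZC : ∀ v, Z v ∈ C := fun v => Submodule.coe_mem _
  have hinj : Function.Injective (f + Z) := by
    rw [← LinearMap.ker_eq_bot, LinearMap.ker_eq_bot']
    intro v hv
    have h1 : f v = 0 ∧ Z v = 0 := by
      have h0 : f v = - Z v := eq_neg_of_add_eq_zero_left hv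
      have : f v = 0 := Submodule.disjoint_def.1 hC.disjoint _
        (h0 ▸ C.neg_mem (hZC v)) ⟨v, rfl⟩
      exact ⟨this, by simpa [this] using hv⟩
    have h2 : Submodule.projectionOnto _ _ hD.symm v = 0 := by
      have := h1.2
      simpa [Z] using this
    rw [Submodule.projectionOnto_apply_eq_zero_iff] at h2
    exact Submodule.disjoint_def.1 hD.disjoint _ h2 h1.1
  refine ⟨LinearEquiv.ofInjectiveEndo (f + Z) hinj, ?_, ?_⟩
  · ext u
    simp [hfX, hZD _ (hXD ⟨u, rfl⟩)]
  · ext v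
    have : Y' (Z v) = 0 := hCY (hZC v)
    simp [hfY, this]


omit [FiniteDimensional K V] in
theorem finrank_ker_comp_sub_pow_le [FiniteDimensional K U] (a : U →ₗ[K] V) (b : V →ₗ[K] U)
    {ν : K} (hν : ν ≠ 0) (k : ℕ) :
    finrank K (LinearMap.ker ((a ∘ₗ b - algebraMap K (End K V) ν) ^ k)) ≤
      finrank K (LinearMap.ker ((b ∘ₗ a - algebraMap K (End K U) ν) ^ k)) := by
  have hcomm : ∀ k v, ((b ∘ₗ a - algebraMap K (End K U) ν) ^ k) (b v) =
      b (((a ∘ₗ b - algebraMap K (End K V) ν) ^ k) v) := by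
    intro k
    induction k with
    | zero => simp
    | succ k ih =>
      intro v
      rw [pow_succ', Module.End.mul_apply, ih, pow_succ', Module.End.mul_apply]
      simp [Module.algebraMap_end_apply]
  have hscal : ∀ v, b v = 0 → ∀ k,
      ((a ∘ₗ b - algebraMap K (End K V) ν) ^ k) v = (-ν) ^ k • v := by
    intro v hv k
    induction k with
    | zero => simp
    | succ k ih =>
      rw [pow_succ', Module.End.mul_apply, ih, map_smul]
      simp [Module.algebraMap_end_apply, hv, pow_succ, mul_smul]
  let b' := b.restrict (p := LinearMap.ker ((a ∘ₗ b - algebraMap K (End K V) ν) ^ k))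
    (q := LinearMap.ker ((b ∘ₗ a - algebraMap K (End K U) ν) ^ k)) (fun v hv => by
      rw [LinearMap.mem_ker, hcomm, LinearMap.mem_ker.1 hv, map_zero])
  refine LinearMap.finrank_le_finrank_of_injective (f := b') ?_
  rw [← LinearMap.ker_eq_bot, LinearMap.ker_eq_bot']
  rintro ⟨v, hv⟩ hbv
  have hbv' : b v = 0 := congrArg Subtype.val hbv
  rw [LinearMap.mem_ker, hscal v hbv', smul_eq_zero] at hv
  exact Subtype.ext (hv.resolve_left (pow_ne_zero _ (neg_ne_zero.2 hν)))

theorem finrank_ker_pow_le_rootMultiplicity (f : End K V) (μ : K) (k : ℕ) :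
    finrank K (LinearMap.ker ((f - algebraMap K (End K V) μ) ^ k)) ≤
      f.charpoly.rootMultiplicity μ := by
  have := f.finrank_genEigenspace_le μ k
  rwa [Module.End.genEigenspace_nat, ← Algebra.algebraMap_eq_smul_one] at this

theorem finrank_ker_pow_finrank_eq_rootMultiplicity (f : End K V) (μ : K) :
    finrank K (LinearMap.ker ((f - algebraMap K (End K V) μ) ^ finrank K V)) =
      f.charpoly.rootMultiplicity μ := by
  rw [← f.finrank_maxGenEigenspace_eq, Module.End.maxGenEigenspace_eq_genEigenspace_finrank,
    Module.End.genEigenspace_nat, ← Algebra.algebraMap_eq_smul_one]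

theorem rootMultiplicity_charpoly_eq_of_finrank_ker_le [IsAlgClosed K] {f g : End K V}
    (h : ∀ (μ : K) (k : ℕ), finrank K (LinearMap.ker ((f - algebraMap K (End K V) μ) ^ k)) ≤
      finrank K (LinearMap.ker ((g - algebraMap K (End K V) μ) ^ k))) (μ : K) :
    f.charpoly.rootMultiplicity μ = g.charpoly.rootMultiplicity μ := by
  classical
  have hcard : ∀ f : End K V, f.charpoly.roots.card = finrank K V := fun f => by
    rw [← f.charpoly_natDegree]
    exact (IsAlgClosed.splits f.charpoly).natDegree_eq_card_roots.symm
  have hle : f.charpoly.roots ≤ g.charpoly.roots := by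
    rw [Multiset.le_iff_count]
    intro ν
    rw [Polynomial.count_roots, Polynomial.count_roots,
      ← finrank_ker_pow_finrank_eq_rootMultiplicity,
      ← finrank_ker_pow_finrank_eq_rootMultiplicity]
    exact h _ _
  rw [← Polynomial.count_roots, ← Polynomial.count_roots,
    Multiset.eq_of_le_of_card_le hle (by rw [hcard, hcard])]

end LinearAlgebra

namespace Matrix

theorem exists_rank_factorization {K : Type*} [Field K] {m n r : ℕ}
    (M : Matrix (Fin m) (Fin n) K) (hr : M.rank = r) :
    ∃ (X : Matrix (Fin m) (Fin r) K) (Y : Matrix (Fin r) (Fin n) K)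
      (L : Matrix (Fin r) (Fin m) K) (R : Matrix (Fin n) (Fin r) K),
      M = X * Y ∧ L * X = 1 ∧ Y * R = 1 := by
  let f := Matrix.toLin' M
  let i : LinearMap.range f ≃ₗ[K] (Fin r → K) :=
    LinearEquiv.ofFinrankEq _ _ (by
      rw [finrank_fin_fun, ← hr, Matrix.rank]
      rfl)
  let x : (Fin r → K) →ₗ[K] (Fin m → K) := (LinearMap.range f).subtype ∘ₗ i.symm.toLinearMap
  let y : (Fin n → K) →ₗ[K] (Fin r → K) := i.toLinearMap ∘ₗ f.rangeRestrict
  have hx : LinearMap.ker x = ⊥ := LinearMap.ker_eq_bot.2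
    ((LinearMap.range f).injective_subtype.comp i.symm.injective)
  have hy : LinearMap.range y = ⊤ := LinearMap.range_eq_top.2
    (i.surjective.comp f.surjective_rangeRestrict)
  obtain ⟨l, hl⟩ := x.exists_leftInverse_of_injective hx
  obtain ⟨s, hs⟩ := y.exists_rightInverse_of_surjective hy
  refine ⟨LinearMap.toMatrix' x, LinearMap.toMatrix' y, LinearMap.toMatrix' l,
    LinearMap.toMatrix' s, ?_, ?_, ?_⟩
  · rw [← LinearMap.toMatrix'_comp]
    have : x ∘ₗ y = f := by
      ext v
      simp [x, y]
    rw [this, LinearMap.toMatrix'_toLin']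
  · rw [← LinearMap.toMatrix'_comp, hl, LinearMap.toMatrix'_id]
  · rw [← LinearMap.toMatrix'_comp, hs, LinearMap.toMatrix'_id]

theorem rank_add_finrank_ker_sub_pow {K : Type*} [Field K] {n : ℕ}
    (M : Matrix (Fin n) (Fin n) K) (μ : K) (k : ℕ) :
    ((M - μ • (1 : Matrix (Fin n) (Fin n) K)) ^ k).rank +
      finrank K (LinearMap.ker
        ((Matrix.toLin' M - algebraMap K (End K (Fin n → K)) μ) ^ k)) = n := by
  have h : (Matrix.toLin' M - algebraMap K (End K (Fin n → K)) μ) ^ k =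
      Matrix.toLin' ((M - μ • (1 : Matrix (Fin n) (Fin n) K)) ^ k) := by
    rw [Matrix.toLin'_pow, map_sub, map_smul, Matrix.toLin'_one, Algebra.algebraMap_eq_smul_one]
    rfl
  rw [h]
  exact (LinearMap.finrank_range_add_finrank_ker
    (Matrix.toLin' ((M - μ • (1 : Matrix (Fin n) (Fin n) K)) ^ k))).trans (finrank_fin_fun K)

theorem isOpen_setOf_le_rank {m n : ℕ} (r : ℕ) :
    IsOpen {M : Matrix (Fin m) (Fin n) ℂ | r ≤ M.rank} := by
  rw [isOpen_iff_mem_nhds]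
  intro M hM
  obtain ⟨X, Y, L, R, hXY, hL, hR⟩ := M.exists_rank_factorization (r := M.rank) rfl
  have hopen : IsOpen {N : Matrix (Fin m) (Fin n) ℂ | (L * N * R).det ≠ 0} :=
    isOpen_ne.preimage (by fun_prop)
  refine Filter.mem_of_superset (hopen.mem_nhds ?_) fun N hN => ?_
  · have : L * M * R = 1 := by
      calc L * M * R = L * (X * Y) * R := congrArg (fun N => L * N * R) hXY
        _ = 1 := by rw [← Matrix.mul_assoc, hL, Matrix.one_mul, hR]
    simp [this]
  · have h1 := rank_of_det_ne_zero hN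
    have h2 := (rank_mul_le_left (L * N) R).trans (rank_mul_le_right L N)
    rw [Fintype.card_fin] at h1
    exact le_trans hM (h1 ▸ h2)

theorem exists_conj_of_mul_eq_mul {K : Type*} [Field K] {n r : ℕ}
    {X X' : Matrix (Fin n) (Fin r) K} {Y Y' : Matrix (Fin r) (Fin n) K}
    (hX : ∃ L : Matrix (Fin r) (Fin n) K, L * X = 1)
    (hX' : ∃ L : Matrix (Fin r) (Fin n) K, L * X' = 1)
    (hY : ∃ R : Matrix (Fin n) (Fin r) K, Y * R = 1)
    (hY' : ∃ R : Matrix (Fin n) (Fin r) K, Y' * R = 1) (h : Y * X = Y' * X') :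
    ∃ P : GL (Fin n) K, X * Y = (P : Matrix (Fin n) (Fin n) K) * (X' * Y') *
      (↑(P⁻¹) : Matrix (Fin n) (Fin n) K) := by
  have hinj : ∀ X : Matrix (Fin n) (Fin r) K, (∃ L : Matrix (Fin r) (Fin n) K, L * X = 1) →
      Function.Injective (Matrix.toLin' X) := by
    rintro X ⟨L, hL⟩
    refine Function.LeftInverse.injective (g := Matrix.toLin' L) fun v => ?_
    rw [← Matrix.toLin'_mul_apply, hL, Matrix.toLin'_one, LinearMap.id_apply]
  have hsurj : ∀ Y : Matrix (Fin r) (Fin n) K, (∃ R : Matrix (Fin n) (Fin r) K, Y * R = 1) →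
      Function.Surjective (Matrix.toLin' Y) := by
    rintro Y ⟨R, hR⟩
    refine Function.RightInverse.surjective (g := Matrix.toLin' R) fun v => ?_
    rw [← Matrix.toLin'_mul_apply, hR, Matrix.toLin'_one, LinearMap.id_apply]
  obtain ⟨P, hP, hP'⟩ := exists_equiv_intertwining (hinj X' hX') (hinj X hX) (hsurj Y' hY')
    (hsurj Y hY) (by rw [← Matrix.toLin'_mul, ← Matrix.toLin'_mul, h])
  let Q : GL (Fin n) K := ⟨LinearMap.toMatrix' P.toLinearMap, LinearMap.toMatrix' P.symm.toLinearMap,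
    by rw [← LinearMap.toMatrix'_comp, LinearEquiv.comp_symm, LinearMap.toMatrix'_id],
    by rw [← LinearMap.toMatrix'_comp, LinearEquiv.symm_comp, LinearMap.toMatrix'_id]⟩
  refine ⟨Q, ?_⟩
  have h1 : (Q : Matrix (Fin n) (Fin n) K) * X' = X := by
    have := congrArg LinearMap.toMatrix' hP
    rwa [LinearMap.toMatrix'_comp, LinearMap.toMatrix'_toLin', LinearMap.toMatrix'_toLin'] at this
  have h2 : Y * (Q : Matrix (Fin n) (Fin n) K) = Y' := by
    have := congrArg LinearMap.toMatrix' hP'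
    rwa [LinearMap.toMatrix'_comp, LinearMap.toMatrix'_toLin', LinearMap.toMatrix'_toLin'] at this
  rw [← h2, ← Matrix.mul_assoc, h1, Matrix.mul_assoc, Matrix.mul_assoc, ← Units.val_mul,
    mul_inv_cancel, Units.val_one, Matrix.mul_one]

/-- The set of matrices similar to `A`. -/
def similarityOrbit {n : ℕ} (A : Matrix (Fin n) (Fin n) ℂ) : Set (Matrix (Fin n) (Fin n) ℂ) :=
  { M | ∃ P : GL (Fin n) ℂ,
    M = (↑P : Matrix (Fin n) (Fin n) ℂ) * A * (↑(P⁻¹) : Matrix (Fin n) (Fin n) ℂ) }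

/-- `PowRankLE B A` means that every power of every shift of `B` has rank at most that of the
corresponding power for `A`. -/
def PowRankLE {n : ℕ} (B A : Matrix (Fin n) (Fin n) ℂ) : Prop :=
  ∀ (μ : ℂ) (k : ℕ), ((B - μ • (1 : Matrix (Fin n) (Fin n) ℂ)) ^ k).rank
    ≤ ((A - μ • (1 : Matrix (Fin n) (Fin n) ℂ)) ^ k).rank

theorem powRankLE_iff {n : ℕ} {A B : Matrix (Fin n) (Fin n) ℂ} :
    PowRankLE B A ↔ ∀ (μ : ℂ) (k : ℕ),
      finrank ℂ (LinearMap.ker ((Matrix.toLin' A - algebraMap ℂ (End ℂ (Fin n → ℂ)) μ) ^ k)) ≤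
        finrank ℂ (LinearMap.ker ((Matrix.toLin' B - algebraMap ℂ (End ℂ (Fin n → ℂ)) μ) ^ k)) := by
  refine forall₂_congr fun μ k => ?_
  have hA := rank_add_finrank_ker_sub_pow A μ k
  have hB := rank_add_finrank_ker_sub_pow B μ k
  omega

theorem powRankLE_of_mem_closure {n : ℕ} {A B : Matrix (Fin n) (Fin n) ℂ}
    (h : B ∈ closure (similarityOrbit A)) : PowRankLE B A := by
  intro μ k
  set c := ((A - μ • (1 : Matrix (Fin n) (Fin n) ℂ)) ^ k).rank
  have hcl : IsClosed {M : Matrix (Fin n) (Fin n) ℂ |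
      ((M - μ • (1 : Matrix (Fin n) (Fin n) ℂ)) ^ k).rank ≤ c} := by
    have h1 : IsClosed {M : Matrix (Fin n) (Fin n) ℂ | M.rank ≤ c} := by
      rw [← isOpen_compl_iff]
      convert isOpen_setOf_le_rank (m := n) (n := n) (c + 1) using 1
      ext M
      simp
    exact h1.preimage (f := fun M => (M - μ • (1 : Matrix (Fin n) (Fin n) ℂ)) ^ k) (by fun_prop)
  refine closure_minimal ?_ hcl h
  rintro _ ⟨P, rfl⟩
  have : ((P : Matrix (Fin n) (Fin n) ℂ) * A * (↑(P⁻¹) : Matrix (Fin n) (Fin n) ℂ) -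
      μ • (1 : Matrix (Fin n) (Fin n) ℂ)) ^ k =
      P * (A - μ • (1 : Matrix (Fin n) (Fin n) ℂ)) ^ k * (↑(P⁻¹) : Matrix (Fin n) (Fin n) ℂ) := by
    rw [← Units.conj_pow]
    congr 1
    rw [mul_sub, sub_mul, mul_smul_comm, mul_one, smul_mul_assoc, Units.mul_inv]
  rw [Set.mem_ofPred_eq, this]
  exact (rank_mul_le_left _ _).trans (rank_mul_le_right _ _)

theorem mem_closure_similarityOrbit_of_sub {n : ℕ} {A B : Matrix (Fin n) (Fin n) ℂ} (μ : ℂ)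
    (h : B - μ • (1 : Matrix (Fin n) (Fin n) ℂ) ∈
      closure (similarityOrbit (A - μ • (1 : Matrix (Fin n) (Fin n) ℂ)))) :
    B ∈ closure (similarityOrbit A) := by
  have := map_mem_closure (f := fun M => M + μ • (1 : Matrix (Fin n) (Fin n) ℂ))
    (t := similarityOrbit A) (by fun_prop) h ?_
  · simpa using this
  · rintro _ ⟨P, rfl⟩
    refine ⟨P, ?_⟩
    beta_reduce
    rw [mul_sub, sub_mul, mul_smul_comm, mul_one, smul_mul_assoc, Units.mul_inv,
      sub_add_cancel]

theorem mul_mem_closure_similarityOrbit {n r : ℕ}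
    {X X' : Matrix (Fin n) (Fin r) ℂ} {Y Y' : Matrix (Fin r) (Fin n) ℂ}
    (hX : ∃ L : Matrix (Fin r) (Fin n) ℂ, L * X = 1)
    (hX' : ∃ L : Matrix (Fin r) (Fin n) ℂ, L * X' = 1)
    (hY : ∃ R : Matrix (Fin n) (Fin r) ℂ, Y * R = 1)
    (hY' : ∃ R : Matrix (Fin n) (Fin r) ℂ, Y' * R = 1)
    (h : Y * X ∈ closure (similarityOrbit (Y' * X'))) :
    X * Y ∈ closure (similarityOrbit (X' * Y')) := by
  obtain ⟨L, hL⟩ := hX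
  obtain ⟨L', hL'⟩ := hX'
  obtain ⟨R, hR⟩ := hY
  obtain ⟨R', hR'⟩ := hY'
  have hopen : IsOpen {M : Matrix (Fin r) (Fin r) ℂ |
      ((Y + (M - Y * X) * L) * R).det ≠ 0} :=
    isOpen_ne.preimage (by fun_prop)
  have hmem := hopen.inter_closure ⟨(by simp [hR]), h⟩
  have := map_mem_closure (f := fun M : Matrix (Fin r) (Fin r) ℂ => X * (Y + (M - Y * X) * L))
    (t := similarityOrbit (X' * Y')) (by fun_prop) hmem ?_
  · simpa using this
  · rintro _ ⟨hdet, P, rfl⟩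
    rw [Set.mem_ofPred_eq] at hdet
    set M := (P : Matrix (Fin r) (Fin r) ℂ) * (Y' * X') *
      (↑(P⁻¹) : Matrix (Fin r) (Fin r) ℂ) with hM
    have hPP : (P : Matrix (Fin r) (Fin r) ℂ) * (↑(P⁻¹) : Matrix (Fin r) (Fin r) ℂ) = 1 :=
      Units.mul_inv P
    have hPP' : (↑(P⁻¹) : Matrix (Fin r) (Fin r) ℂ) * (P : Matrix (Fin r) (Fin r) ℂ) = 1 :=
      Units.inv_mul P
    obtain ⟨Q, hQ⟩ := exists_conj_of_mul_eq_mul (X := X)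
      (X' := X' * (↑(P⁻¹) : Matrix (Fin r) (Fin r) ℂ))
      (Y := Y + (M - Y * X) * L) (Y' := (P : Matrix (Fin r) (Fin r) ℂ) * Y') ⟨L, hL⟩
      ⟨(P : Matrix (Fin r) (Fin r) ℂ) * L', by
        rw [Matrix.mul_assoc, ← Matrix.mul_assoc L', hL', Matrix.one_mul, hPP]⟩
      ⟨R * ((Y + (M - Y * X) * L) * R)⁻¹, by
        rw [← Matrix.mul_assoc, Matrix.mul_nonsing_inv _ (isUnit_iff_ne_zero.2 hdet)]⟩
      ⟨R' * (↑(P⁻¹) : Matrix (Fin r) (Fin r) ℂ), by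
        rw [Matrix.mul_assoc, ← Matrix.mul_assoc Y', hR', Matrix.one_mul, hPP]⟩
      (by
        rw [Matrix.add_mul, Matrix.mul_assoc, hL, Matrix.mul_one, add_sub_cancel, hM]
        simp only [Matrix.mul_assoc])
    refine ⟨Q, ?_⟩
    have h1 : X' * (↑(P⁻¹) : Matrix (Fin r) (Fin r) ℂ) *
        ((P : Matrix (Fin r) (Fin r) ℂ) * Y') = X' * Y' := by
      rw [Matrix.mul_assoc, ← Matrix.mul_assoc _ (P : Matrix (Fin r) (Fin r) ℂ), hPP',
        Matrix.one_mul]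
    rw [h1] at hQ
    exact hQ

theorem rank_mul_swap_pow {K : Type*} [Field K] {n r : ℕ} {X : Matrix (Fin n) (Fin r) K}
    {Y : Matrix (Fin r) (Fin n) K}
    (hX : ∃ L : Matrix (Fin r) (Fin n) K, L * X = 1)
    (hY : ∃ R : Matrix (Fin n) (Fin r) K, Y * R = 1) (k : ℕ) :
    ((Y * X) ^ k).rank = ((X * Y) ^ (k + 1)).rank := by
  obtain ⟨L, hL⟩ := hX
  obtain ⟨R, hR⟩ := hY
  have h : (X * Y) ^ (k + 1) = X * (Y * X) ^ k * Y := by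
    induction k with
    | zero => simp
    | succ k ih =>
      rw [pow_succ, ih, pow_succ]
      simp only [Matrix.mul_assoc]
  refine le_antisymm ?_ ?_
  · have h' : (Y * X) ^ k = L * (X * Y) ^ (k + 1) * R := by
      rw [h, Matrix.mul_assoc, Matrix.mul_assoc, hR, Matrix.mul_one, ← Matrix.mul_assoc, hL,
        Matrix.one_mul]
    rw [h']
    exact (rank_mul_le_left _ _).trans (rank_mul_le_right _ _)
  · rw [h]
    exact (rank_mul_le_left _ _).trans (rank_mul_le_right _ _)

theorem PowRankLE.mul_swap {n r : ℕ}
    {X X' : Matrix (Fin n) (Fin r) ℂ} {Y Y' : Matrix (Fin r) (Fin n) ℂ}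
    (hX : ∃ L : Matrix (Fin r) (Fin n) ℂ, L * X = 1)
    (hX' : ∃ L : Matrix (Fin r) (Fin n) ℂ, L * X' = 1)
    (hY : ∃ R : Matrix (Fin n) (Fin r) ℂ, Y * R = 1)
    (hY' : ∃ R : Matrix (Fin n) (Fin r) ℂ, Y' * R = 1)
    (h : PowRankLE (X * Y) (X' * Y')) : PowRankLE (Y * X) (Y' * X') := by
  intro μ k
  rcases eq_or_ne μ 0 with rfl | hμ
  · simpa [rank_mul_swap_pow hX hY, rank_mul_swap_pow hX' hY'] using h 0 (k + 1)
  · have h1 := powRankLE_iff.1 h μ k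
    rw [Matrix.toLin'_mul, Matrix.toLin'_mul] at h1
    have h2 := finrank_ker_comp_sub_pow_le (Matrix.toLin' X) (Matrix.toLin' Y) hμ k
    have h3 := finrank_ker_comp_sub_pow_le (Matrix.toLin' Y') (Matrix.toLin' X') hμ k
    have h4 := rank_add_finrank_ker_sub_pow (Y * X) μ k
    have h5 := rank_add_finrank_ker_sub_pow (Y' * X') μ k
    rw [Matrix.toLin'_mul] at h4 h5
    omega

theorem mem_closure_similarityOrbit_of_singular {n : ℕ}
    (ih : ∀ r < n, ∀ A B : Matrix (Fin r) (Fin r) ℂ, PowRankLE B A →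
      B ∈ closure (similarityOrbit A))
    (A : Matrix (Fin n) (Fin n) ℂ) (hA : A.rank < n) (B : Matrix (Fin n) (Fin n) ℂ)
    (h : PowRankLE B A) : B ∈ closure (similarityOrbit A) := by
  classical
  induction hs : ∑ k ∈ Finset.range (n + 1), finrank ℂ (LinearMap.ker (Matrix.toLin' B ^ k))
    using Nat.strong_induction_on generalizing B with
  | _ s ihs =>
  have hker := powRankLE_iff.1 h
  have hzero : ∀ f : End ℂ (Fin n → ℂ), f - algebraMap ℂ (End ℂ (Fin n → ℂ)) 0 = f := fun f => by
    rw [map_zero, sub_zero]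
  have hker0 : ∀ k, finrank ℂ (LinearMap.ker (Matrix.toLin' A ^ k)) ≤
      finrank ℂ (LinearMap.ker (Matrix.toLin' B ^ k)) := fun k => by
    have := hker 0 k
    rwa [hzero, hzero] at this
  have hex : ∃ m, finrank ℂ (LinearMap.ker (Matrix.toLin' B ^ (m + 1))) ≤
      finrank ℂ (LinearMap.ker (Matrix.toLin' A ^ (m + 1))) ∧ m ≤ n := by
    refine ⟨n, ?_, le_rfl⟩
    have h1 := finrank_ker_pow_le_rootMultiplicity (Matrix.toLin' B) 0 (n + 1)
    have h2 := finrank_ker_pow_finrank_eq_rootMultiplicity (Matrix.toLin' A) 0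
    rw [← rootMultiplicity_charpoly_eq_of_finrank_ker_le hker, ← h2, finrank_fin_fun, hzero,
      hzero] at h1
    refine h1.trans (Submodule.finrank_mono ?_)
    rw [pow_succ', Module.End.mul_eq_comp]
    exact LinearMap.ker_le_ker_comp _ _
  obtain ⟨m, ⟨hm, hmn⟩, hleast⟩ : ∃ m, (finrank ℂ (LinearMap.ker (Matrix.toLin' B ^ (m + 1))) ≤
      finrank ℂ (LinearMap.ker (Matrix.toLin' A ^ (m + 1))) ∧ m ≤ n) ∧
      ∀ j < m, ¬ (finrank ℂ (LinearMap.ker (Matrix.toLin' B ^ (j + 1))) ≤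
        finrank ℂ (LinearMap.ker (Matrix.toLin' A ^ (j + 1))) ∧ j ≤ n) :=
    ⟨Nat.find hex, Nat.find_spec hex, fun _ => Nat.find_min hex⟩
  have hmin : ∀ j < m, finrank ℂ (LinearMap.ker (Matrix.toLin' A ^ (j + 1))) <
      finrank ℂ (LinearMap.ker (Matrix.toLin' B ^ (j + 1))) := fun j hj =>
    not_le.1 fun hle => hleast j hj ⟨hle, by omega⟩
  rcases m with _ | m
  · have hrank : B.rank = A.rank := by
      have h1 := rank_add_finrank_ker_sub_pow A 0 1
      have h2 := rank_add_finrank_ker_sub_pow B 0 1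
      have h3 := hker0 1
      rw [hzero, pow_one (A - _), zero_smul, sub_zero] at h1
      rw [hzero, pow_one (B - _), zero_smul, sub_zero] at h2
      rw [zero_add] at hm
      omega
    obtain ⟨X, Y, L, R, hB, hL, hR⟩ := B.exists_rank_factorization hrank
    obtain ⟨X', Y', L', R', hA', hL', hR'⟩ := A.exists_rank_factorization rfl
    have := mul_mem_closure_similarityOrbit ⟨L, hL⟩ ⟨L', hL'⟩ ⟨R, hR⟩ ⟨R', hR'⟩
      (ih _ hA _ _ (PowRankLE.mul_swap ⟨L, hL⟩ ⟨L', hL'⟩ ⟨R, hR⟩ ⟨R', hR'⟩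
        (by rw [← hB, ← hA']; exact h)))
    rwa [← hB, ← hA'] at this
  · have hconc : finrank ℂ (LinearMap.ker (Matrix.toLin' B ^ (m + 1 + 1))) + 2 ≤
        finrank ℂ (LinearMap.ker (Matrix.toLin' B)) +
          finrank ℂ (LinearMap.ker (Matrix.toLin' B ^ (m + 1))) := by
      have h1 := finrank_ker_pow_succ_le (Matrix.toLin' A) (m + 1)
      have h2 := hmin 0 (by omega)
      have h3 := hmin m (by omega)
      rw [zero_add, pow_one, pow_one] at h2
      omega
    obtain ⟨E, hE⟩ := exists_rank_one_modification (Matrix.toLin' B) (m + 1) hconc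
    have hmem : ∀ t : ℂ, t ≠ 0 → B + t • LinearMap.toMatrix' E ∈ closure (similarityOrbit A) := by
      intro t ht
      obtain ⟨hle, ⟨k₀, hk₀, hlt⟩, htop, hge, hne⟩ := hE t ht
      have hlin : Matrix.toLin' (B + t • LinearMap.toMatrix' E) = Matrix.toLin' B + t • E := by
        simp
      refine ihs _ ?_ _ ?_ rfl
      · rw [← hs, hlin]
        exact Finset.sum_lt_sum (fun k _ => hle k)
          ⟨k₀, Finset.mem_range.2 (by omega), hlt⟩
      · rw [powRankLE_iff, hlin]
        intro ν k
        rcases eq_or_ne ν 0 with rfl | hν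
        · rw [hzero, hzero]
          by_cases hk : m + 1 < k
          · rw [htop k hk]
            exact hker0 k
          · rcases k with _ | k
            · exact le_rfl
            · have h1 := hmin k (by omega)
              have h2 := hge (k + 1)
              omega
        · rw [hne ν hν]
          exact hker ν k
    have hlim : Filter.Tendsto (fun t : ℂ => B + t • LinearMap.toMatrix' E)
        (nhdsWithin 0 {0}ᶜ) (nhds B) := by
      have : Continuous fun t : ℂ => B + t • LinearMap.toMatrix' E := by fun_prop
      simpa using (this.tendsto 0).mono_left nhdsWithin_le_nhds
    exact isClosed_closure.mem_of_tendsto hlim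
      (eventually_nhdsWithin_of_forall fun t ht => hmem t ht)

theorem PowRankLE.mem_closure_similarityOrbit {n : ℕ} {A B : Matrix (Fin n) (Fin n) ℂ}
    (h : PowRankLE B A) : B ∈ closure (similarityOrbit A) := by
  induction n using Nat.strong_induction_on with
  | _ n ih =>
  rcases Nat.eq_zero_or_pos n with rfl | hn
  · exact subset_closure ⟨1, Subsingleton.elim _ _⟩
  · have : Nonempty (Fin n) := ⟨⟨0, hn⟩⟩
    obtain ⟨μ, hμ⟩ := Module.End.exists_eigenvalue (Matrix.toLin' A)
    refine mem_closure_similarityOrbit_of_sub μ (mem_closure_similarityOrbit_of_singular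
      (fun r hr A B h => ih r hr h) _ ?_ _ fun ν k => ?_)
    · have h1 := rank_add_finrank_ker_sub_pow A μ 1
      have h2 := Module.End.pos_finrank_genEigenspace_of_hasEigenvalue hμ (k := 1) one_pos
      rw [Module.End.genEigenspace_nat, ← Algebra.algebraMap_eq_smul_one] at h2
      rw [pow_one (A - _)] at h1
      omega
    · simpa [sub_sub, ← add_smul] using h (μ + ν) k

end Matrix

/-- Characterization of the closure of a similarity orbit of a complex matrix: `A₂` lies in
the closure of the similarity orbit of `A₁` if and only if
`rank((A₂ − μI)^k) ≤ rank((A₁ − μI)^k)` for all `μ ∈ ℂ` and all `k ∈ ℕ`. -/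
theorem mem_closure_similarity_orbit_iff (n : ℕ) (hn : 1 ≤ n)
    (A₁ A₂ : Matrix (Fin n) (Fin n) ℂ) :
    A₂ ∈ closure { M : Matrix (Fin n) (Fin n) ℂ |
        ∃ P : GL (Fin n) ℂ,
          M = (↑P : Matrix (Fin n) (Fin n) ℂ) * A₁ * (↑(P⁻¹) : Matrix (Fin n) (Fin n) ℂ) }
      ↔ ∀ (μ : ℂ) (k : ℕ),
          ((A₂ - μ • (1 : Matrix (Fin n) (Fin n) ℂ)) ^ k).rank
            ≤ ((A₁ - μ • (1 : Matrix (Fin n) (Fin n) ℂ)) ^ k).rank := by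
  exact ⟨Matrix.powRankLE_of_mem_closure, fun h => Matrix.PowRankLE.mem_closure_similarityOrbit h⟩
end
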